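/- Let S be a Seidel matrix of order n ≥ 277 with smallest eigenvalue exactly −5, such that the clique number ω([S]) of the switching class of S equals 4. If the independence number α([S]) of the switching class of S satisfies α([S]) ≥ 39, then rk(S + 5I) ≥ 2n/3 + 1. -/

import Mathlib

open Matrix

/-- A Seidel matrix: symmetric, zero diagonal, off-diagonal entries `±1`. -/
def IsSeidel {n : ℕ} (S : Matrix (Fin n) (Fin n) ℝ) : Prop :=
  S.IsSymm ∧ (∀ i, S i i = 0) ∧ ∀ i j, i ≠ j → S i j = 1 ∨ S i j = -1

/-- Smallest eigenvalue of a real symmetric matrix (junk value `0` if not Hermitian). -/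
noncomputable def minEig {m : Type*} [Fintype m] [DecidableEq m] (A : Matrix m m ℝ) : ℝ := by
  classical
  exact if hA : A.IsHermitian then ⨅ i, hA.eigenvalues i else 0

/-- Largest eigenvalue of a real symmetric matrix (junk value `0` if not Hermitian). -/
noncomputable def maxEig {m : Type*} [Fintype m] [DecidableEq m] (A : Matrix m m ℝ) : ℝ := by
  classical
  exact if hA : A.IsHermitian then ⨆ i, hA.eigenvalues i else 0

/-- The Seidel matrix of a simple graph `G`, i.e. `J - I - 2A(G)`:
zero diagonal, `-1` on adjacent pairs, `1` on distinct non-adjacent pairs. -/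
noncomputable def seidelOf {V : Type*} [Fintype V] (G : SimpleGraph V) : Matrix V V ℝ := by
  classical
  exact Matrix.of fun i j => if i = j then 0 else if G.Adj i j then -1 else 1

/-- Smallest eigenvalue of the Seidel matrix of a finite graph. -/
noncomputable def minSeidelEig {V : Type*} [Finite V] (G : SimpleGraph V) : ℝ := by
  classical
  letI := Fintype.ofFinite V
  exact minEig (seidelOf G)

/-- Spectral radius (largest adjacency eigenvalue) of a finite graph. -/
noncomputable def specRad {V : Type*} [Finite V] (G : SimpleGraph V) : ℝ := by
  classical
  letI := Fintype.ofFinite V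
  exact maxEig (G.adjMatrix ℝ)

/-- Switching equivalence: `T = D S D` for some diagonal `±1` matrix `D`. -/
def SwEquiv {n : ℕ} (S T : Matrix (Fin n) (Fin n) ℝ) : Prop :=
  ∃ ε : Fin n → ℝ, (∀ i, ε i = 1 ∨ ε i = -1) ∧
    T = Matrix.diagonal ε * S * Matrix.diagonal ε

/-- The switching graph of a Seidel matrix `S`: the graph on `2n` vertices whose Seidel
matrix is the block matrix `((S, I - S), (I - S, S))`, adjacency given by entries `-1`. -/
def switchGraph {n : ℕ} (S : Matrix (Fin n) (Fin n) ℝ) : SimpleGraph (Fin n ⊕ Fin n) :=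
  SimpleGraph.fromRel fun x y => Matrix.fromBlocks S (1 - S) (1 - S) S x y = -1

/-- Independence number of a graph. -/
noncomputable def indepNum {V : Type*} (G : SimpleGraph V) : ℕ := Gᶜ.cliqueNum

/-- The graph consisting of `t` disjoint copies of `K₂`. -/
def nK2 (t : ℕ) : SimpleGraph (Fin t × Fin 2) :=
  SimpleGraph.fromRel fun p q => p.1 = q.1

section Part1
open Finset
open scoped Classical in
/-- 0/1 adjacency. -/
noncomputable def ad {V : Type*} (G : SimpleGraph V) (u v : V) : ℝ := if G.Adj u v then 1 else 0

/-- quadratic form of `4I - 2A`. -/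
noncomputable def qf {V : Type*} [Fintype V] (G : SimpleGraph V) (x : V → ℝ) : ℝ :=
  4 * ∑ v, x v ^ 2 - 2 * ∑ u, ∑ v, ad G u v * (x u * x v)

lemma ad_nonneg {V : Type*} (G : SimpleGraph V) (u v : V) : 0 ≤ ad G u v := by
  unfold ad; split_ifs <;> norm_num

lemma ad_symm {V : Type*} (G : SimpleGraph V) (u v : V) : ad G u v = ad G v u := by
  by_cases h : G.Adj u v
  · simp [ad, h, h.symm]
  · simp [ad, h, G.adj_comm v u]

lemma ad_of_adj {V : Type*} {G : SimpleGraph V} {u v : V} (h : G.Adj u v) : ad G u v = 1 := by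
  unfold ad; simp [h]

lemma ad_of_not {V : Type*} {G : SimpleGraph V} {u v : V} (h : ¬ G.Adj u v) : ad G u v = 0 := by
  unfold ad; simp [h]

lemma ad_sq {V : Type*} (G : SimpleGraph V) (u v : V) : ad G u v ^ 2 = ad G u v := by
  unfold ad; split_ifs <;> norm_num

lemma qf_abs_le {V : Type*} [Fintype V] (G : SimpleGraph V) (x : V → ℝ) :
    qf G (fun v => |x v|) ≤ qf G x := by
  unfold qf
  have h : ∑ u, ∑ v, ad G u v * (x u * x v) ≤ ∑ u, ∑ v, ad G u v * (|x u| * |x v|) := by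
    refine sum_le_sum fun u _ => sum_le_sum fun v _ => ?_
    refine mul_le_mul_of_nonneg_left ?_ (ad_nonneg _ _ _)
    rw [← abs_mul]; exact le_abs_self _
  simp only [sq_abs]
  linarith

lemma qf_comb {V : Type*} [Fintype V] (G : SimpleGraph V) (x y : V → ℝ) (s t : ℝ) :
    qf G (fun v => s * x v + t * y v) = s ^ 2 * qf G x + t ^ 2 * qf G y
      + 2 * s * t * (4 * ∑ v, x v * y v - 2 * ∑ u, ∑ v, ad G u v * (x u * y v)) := by
  have h1 : ∑ u, ∑ v, ad G u v * (y u * x v) = ∑ u, ∑ v, ad G u v * (x u * y v) := by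
    rw [sum_comm]
    refine sum_congr rfl fun u _ => sum_congr rfl fun v _ => ?_
    rw [ad_symm]; ring
  have h2 : ∑ u, ∑ v, ad G u v * ((s * x u + t * y u) * (s * x v + t * y v)) =
      s ^ 2 * (∑ u, ∑ v, ad G u v * (x u * x v)) + t ^ 2 * (∑ u, ∑ v, ad G u v * (y u * y v))
      + s * t * (∑ u, ∑ v, ad G u v * (x u * y v)) + s * t * (∑ u, ∑ v, ad G u v * (y u * x v)) := by
    simp only [mul_sum, ← sum_add_distrib]
    refine sum_congr rfl fun u _ => sum_congr rfl fun v _ => ?_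
    ring
  have h3 : ∑ v, (s * x v + t * y v) ^ 2 = s ^ 2 * ∑ v, x v ^ 2 + t ^ 2 * ∑ v, y v ^ 2
      + 2 * s * t * ∑ v, x v * y v := by
    simp only [mul_sum, ← sum_add_distrib]
    refine sum_congr rfl fun u _ => ?_
    ring
  unfold qf
  rw [h2, h3, h1]; ring

/-- kernel of `4I-2A+J`. -/
def kerM {V : Type*} [Fintype V] (G : SimpleGraph V) : Submodule ℝ (V → ℝ) where
  carrier := {x | ∀ v, 4 * x v - 2 * ∑ u, ad G v u * x u + ∑ u, x u = 0}
  add_mem' := by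
    intro x y hx hy v
    have h1 := hx v
    have h2 := hy v
    simp only [Pi.add_apply, mul_add, sum_add_distrib]
    linarith
  zero_mem' := by intro v; simp
  smul_mem' := by
    intro c x hx v
    have h1 := hx v
    have : ∀ v, ad G v = fun u => ad G v u := fun _ => rfl
    simp only [Pi.smul_apply, smul_eq_mul]
    have e1 : ∑ u, ad G v u * (c * x u) = c * ∑ u, ad G v u * x u := by
      rw [mul_sum]; exact sum_congr rfl fun u _ => by ring
    rw [e1, ← mul_sum]
    linear_combination c * h1

/-- kernel of `4I-2A`. -/
def kerB {V : Type*} [Fintype V] (G : SimpleGraph V) : Submodule ℝ (V → ℝ) where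
  carrier := {x | ∀ v, 4 * x v - 2 * ∑ u, ad G v u * x u = 0}
  add_mem' := by
    intro x y hx hy v
    have h1 := hx v
    have h2 := hy v
    simp only [Pi.add_apply, mul_add, sum_add_distrib]
    linarith
  zero_mem' := by intro v; simp
  smul_mem' := by
    intro c x hx v
    have h1 := hx v
    simp only [Pi.smul_apply, smul_eq_mul]
    have e1 : ∑ u, ad G v u * (c * x u) = c * ∑ u, ad G v u * x u := by
      rw [mul_sum]; exact sum_congr rfl fun u _ => by ring
    rw [e1]
    linear_combination c * h1

lemma qf_eq {V : Type*} [Fintype V] (G : SimpleGraph V) (x : V → ℝ) :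
    qf G x = ∑ v, x v * (4 * x v - 2 * ∑ u, ad G v u * x u) := by
  unfold qf
  simp only [mul_sum, mul_sub, sum_sub_distrib]
  congr 1
  · exact sum_congr rfl fun u _ => by ring
  · exact sum_congr rfl fun u _ => sum_congr rfl fun v _ => by ring

lemma kerM_form {V : Type*} [Fintype V] {G : SimpleGraph V} {x : V → ℝ} (hx : x ∈ kerM G) :
    qf G x + (∑ v, x v) ^ 2 = 0 := by
  rw [qf_eq, sq, sum_mul, ← sum_add_distrib]
  refine sum_eq_zero fun v _ => ?_
  have h : 4 * x v - 2 * ∑ u, ad G v u * x u + ∑ u, x u = 0 := hx v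
  linear_combination x v * h

lemma finrank_le_of_vanish {V : Type*} [Fintype V] (K : Submodule ℝ (V → ℝ)) (T : Finset V)
    (h : ∀ x ∈ K, (∀ v ∈ T, x v = 0) → x = 0) : Module.finrank ℝ K ≤ #T := by
  let φ : K →ₗ[ℝ] (T → ℝ) :=
    { toFun := fun x v => x.1 v.1
      map_add' := fun x y => rfl
      map_smul' := fun c x => rfl }
  have hφ : Function.Injective φ := by
    rw [injective_iff_map_eq_zero]
    intro x hx
    apply Subtype.ext
    refine h x.1 x.2 fun v hv => ?_
    exact congrFun hx ⟨v, hv⟩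
  have := LinearMap.finrank_le_finrank_of_injective hφ
  simpa using this

open scoped Classical in
/-- closed neighbourhood of a finset -/
noncomputable def cnbr {V : Type*} [Fintype V] (G : SimpleGraph V) (F : Finset V) : Finset V :=
  F.biUnion fun v => insert v (univ.filter (G.Adj v))

open scoped Classical in
noncomputable def dg {V : Type*} [Fintype V] (G : SimpleGraph V) (v : V) : ℕ := #(univ.filter (G.Adj v))

lemma card_cnbr_le {V : Type*} [Fintype V] (G : SimpleGraph V) (F : Finset V) :
    #(cnbr G F) ≤ ∑ v ∈ F, (dg G v + 1) := by
  classical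
  refine card_biUnion_le.trans (sum_le_sum fun v _ => ?_)
  unfold dg
  refine (card_insert_le _ _).trans ?_
  convert le_refl _

lemma bad_finrank {V : Type*} [Fintype V] (G : SimpleGraph V)
    (hpsd : ∀ x : V → ℝ, 0 ≤ qf G x + (∑ v, x v) ^ 2)
    (F : Finset V) (f : V → ℝ) (hF : ∀ v, v ∉ F → f v = 0) (hq : qf G f < 0) :
    Module.finrank ℝ (kerM G) ≤ #(cnbr G F) := by
  classical
  refine finrank_le_of_vanish _ _ fun x hx hv => ?_
  by_contra hne
  have h0 := kerM_form hx
  have h1 := qf_abs_le G x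
  obtain ⟨w, hw⟩ : ∃ w, x w ≠ 0 := by
    by_contra hcon; push Not at hcon; exact hne (funext hcon)
  have hα : 0 < ∑ v, |x v| :=
    sum_pos' (fun v _ => abs_nonneg _) ⟨w, mem_univ _, abs_pos.2 hw⟩
  set α := ∑ v, |x v| with hαd
  set β := ∑ v, f v with hβd
  have hx0 : ∀ u v, f u ≠ 0 → (u = v ∨ G.Adj u v) → x v = 0 := by
    intro u v hu huv
    apply hv
    have huF : u ∈ F := by by_contra hh; exact hu (hF u hh)
    simp only [cnbr, mem_biUnion, mem_insert, mem_filter, mem_univ, true_and]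
    exact ⟨u, huF, by tauto⟩
  have hc := qf_comb G f (fun v => |x v|) α (-β)
  have z1 : ∑ v, f v * |x v| = 0 := sum_eq_zero fun v _ => by
    by_cases hfv : f v = 0
    · simp [hfv]
    · simp [hx0 v v hfv (Or.inl rfl)]
  have z2 : ∑ u, ∑ v, ad G u v * (f u * |x v|) = 0 :=
    sum_eq_zero fun u _ => sum_eq_zero fun v _ => by
      by_cases hfv : f u = 0
      · simp [hfv]
      · by_cases hadj : G.Adj u v
        · simp [hx0 u v hfv (Or.inr hadj)]
        · simp [ad_of_not hadj]
  rw [z1, z2] at hc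
  have hp := hpsd (fun v => α * f v + -β * |x v|)
  have hs : ∑ v, (α * f v + -β * |x v|) = 0 := by
    rw [sum_add_distrib, ← mul_sum, ← mul_sum]; ring
  rw [hs, hc] at hp
  have hle : qf G (fun v => |x v|) ≤ 0 := by nlinarith [sq_nonneg (∑ v, x v)]
  have : α ^ 2 * qf G f < 0 := mul_neg_of_pos_of_neg (by positivity) hq
  nlinarith [sq_nonneg β]

end Part1

section Part2
open Finset

lemma kerB_of_zero {V : Type*} [Fintype V] {G : SimpleGraph V}
    (hB : ∀ x : V → ℝ, 0 ≤ qf G x) {x : V → ℝ} (hx : qf G x ≤ 0) : x ∈ kerB G := by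
  classical
  intro v
  have hx0 : qf G x = 0 := le_antisymm hx (hB x)
  set y : V → ℝ := Pi.single v 1 with hy
  have e1 : ∑ u, x u * y u = x v := by simp [hy, Pi.single_apply]
  have e2 : ∑ u, ∑ w, ad G u w * (x u * y w) = ∑ u, ad G v u * x u := by
    refine sum_congr rfl fun u _ => ?_
    simp [hy, Pi.single_apply, ad_symm G u v]
  set b := 4 * x v - 2 * ∑ u, ad G v u * x u with hb
  have key : ∀ t : ℝ, 0 ≤ t ^ 2 * qf G y + 2 * t * b := by
    intro t
    have h := qf_comb G x y 1 t
    rw [e1, e2, hx0] at h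
    have h2 := hB (fun v => 1 * x v + t * y v)
    rw [h] at h2
    linarith
  set c := qf G y with hc
  have hc0 : 0 ≤ c := hB y
  have h := key (-b / (c + 1))
  have hcp : 0 < c + 1 := by linarith
  have e : (-b / (c + 1)) ^ 2 * c + 2 * (-b / (c + 1)) * b = - (b ^ 2 * (c + 2)) / (c + 1) ^ 2 := by
    field_simp; ring
  rw [e] at h
  have h3 : b ^ 2 * (c + 2) ≤ 0 := by
    by_contra hh
    push Not at hh
    have : - (b ^ 2 * (c + 2)) / (c + 1) ^ 2 < 0 := div_neg_of_neg_of_pos (by linarith) (by positivity)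
    linarith
  have h4 : b ^ 2 ≤ 0 := by nlinarith [sq_nonneg b, mul_nonneg (sq_nonneg b) hc0]
  exact pow_eq_zero_iff (two_ne_zero) |>.1 (le_antisymm h4 (sq_nonneg b))

lemma kerB_form {V : Type*} [Fintype V] {G : SimpleGraph V} {x : V → ℝ} (hx : x ∈ kerB G) :
    qf G x = 0 := by
  rw [qf_eq]
  refine sum_eq_zero fun v _ => ?_
  have h : 4 * x v - 2 * ∑ u, ad G v u * x u = 0 := hx v
  rw [h, mul_zero]

lemma kerB_abs {V : Type*} [Fintype V] {G : SimpleGraph V}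
    (hB : ∀ x : V → ℝ, 0 ≤ qf G x) {x : V → ℝ} (hx : x ∈ kerB G) : (fun v => |x v|) ∈ kerB G := by
  apply kerB_of_zero hB
  have := qf_abs_le G x
  rw [kerB_form hx] at this
  exact this

lemma kerB_adj {V : Type*} [Fintype V] {G : SimpleGraph V}
    (hB : ∀ x : V → ℝ, 0 ≤ qf G x) {x : V → ℝ} (hx : x ∈ kerB G) {v w : V} (hv : x v = 0)
    (h : G.Adj v w) : x w = 0 := by
  have h1 : 4 * |x v| - 2 * ∑ u, ad G v u * |x u| = 0 := kerB_abs hB hx v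
  rw [hv, abs_zero] at h1
  have h2 : ∑ u, ad G v u * |x u| = 0 := by linarith
  rw [sum_eq_zero_iff_of_nonneg (fun u _ => mul_nonneg (ad_nonneg _ _ _) (abs_nonneg _))] at h2
  have h3 := h2 w (mem_univ _)
  rw [ad_of_adj h, one_mul, abs_eq_zero] at h3
  exact h3

lemma kerB_reach {V : Type*} [Fintype V] {G : SimpleGraph V}
    (hB : ∀ x : V → ℝ, 0 ≤ qf G x) {x : V → ℝ} (hx : x ∈ kerB G) {v w : V} (hv : x v = 0)
    (h : G.Reachable v w) : x w = 0 := by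
  obtain ⟨p⟩ := h
  induction p with
  | nil => exact hv
  | cons h p ih => exact ih (kerB_adj hB hx hv h)

lemma sum_ad_mul {V : Type*} [Fintype V] [DecidableEq V] (G : SimpleGraph V) [DecidableRel G.Adj] (v : V) (x : V → ℝ) :
    ∑ u, ad G v u * x u = ∑ u ∈ univ.filter (G.Adj v), x u := by
  rw [sum_filter]
  refine sum_congr rfl fun u _ => ?_
  by_cases h : G.Adj v u <;> simp [ad, h]

lemma psd_finrank {V : Type*} [Fintype V] (G : SimpleGraph V)
    (hB : ∀ x : V → ℝ, 0 ≤ qf G x) (hcard : 3 ≤ Fintype.card V) :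
    3 * (Module.finrank ℝ (kerM G) + 1) ≤ Fintype.card V := by
  classical
  have hle : kerM G ≤ kerB G := by
    intro x hx
    apply kerB_of_zero hB
    have := kerM_form hx
    nlinarith [sq_nonneg (∑ v, x v)]
  by_cases hbot : kerB G = ⊥
  · have : kerM G = ⊥ := by rw [hbot] at hle; exact le_bot_iff.1 hle
    rw [this]; simpa using hcard
  have hlt : kerM G < kerB G := by
    refine lt_of_le_of_ne hle fun heq => ?_
    obtain ⟨x, hx, hne⟩ := (Submodule.ne_bot_iff _).1 hbot
    have ha := kerB_abs hB hx
    have hq := kerB_form ha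
    rw [← heq] at ha
    have hs := kerM_form ha
    rw [hq] at hs
    have hs0 : ∑ v, |x v| = 0 := by
      have : (∑ v, |x v|) ^ 2 = 0 := by linarith
      exact pow_eq_zero_iff two_ne_zero |>.1 this
    rw [sum_eq_zero_iff_of_nonneg (fun u _ => abs_nonneg _)] at hs0
    exact hne (funext fun v => abs_eq_zero.1 (hs0 v (mem_univ _)))
  have h1 := Submodule.finrank_lt_finrank_of_lt hlt
  let C : Finset G.ConnectedComponent :=
    univ.filter fun c => ∃ x ∈ kerB G, ∃ v, G.connectedComponentMk v = c ∧ x v ≠ 0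
  let rep : G.ConnectedComponent → V := fun c => c.out
  have hrep : ∀ c : G.ConnectedComponent, G.connectedComponentMk (rep c) = c := fun c => Quot.out_eq c
  have h2 : Module.finrank ℝ (kerB G) ≤ #(C.image rep) := by
    refine finrank_le_of_vanish _ _ fun x hx hv => ?_
    funext v
    by_contra hne
    have hc : G.connectedComponentMk v ∈ C := by
      simp only [C, mem_filter, mem_univ, true_and]
      exact ⟨x, hx, v, rfl, hne⟩
    have h0 := hv _ (mem_image_of_mem rep hc)
    exact hne (kerB_reach hB hx h0 (SimpleGraph.ConnectedComponent.eq.1 (hrep _)))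
  have h3 : #(C.image rep) ≤ #C := card_image_le
  have h4 : 3 * #C ≤ Fintype.card V := by
    have hfib : ∀ c ∈ C, 3 ≤ #(univ.filter fun v => G.connectedComponentMk v = c) := by
      intro c hc
      simp only [C, mem_filter, mem_univ, true_and] at hc
      obtain ⟨x, hx, v, hvc, hne⟩ := hc
      obtain ⟨w, hw, hmax⟩ := exists_max_image (univ.filter fun v => G.connectedComponentMk v = c)
        (fun v => |x v|) ⟨v, by simp [hvc]⟩
      simp only [mem_filter, mem_univ, true_and] at hw hmax
      have hwpos : 0 < |x w| := lt_of_lt_of_le (abs_pos.2 hne) (hmax v hvc)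
      have hb : 4 * |x w| - 2 * ∑ u, ad G w u * |x u| = 0 := kerB_abs hB hx w
      rw [sum_ad_mul] at hb
      have hsame : ∀ u, G.Adj w u → G.connectedComponentMk u = c := by
        intro u hu
        rw [← hw]; exact SimpleGraph.ConnectedComponent.eq.2 hu.symm.reachable
      have hbd : ∑ u ∈ univ.filter (G.Adj w), |x u| ≤ #(univ.filter (G.Adj w)) • |x w| :=
        sum_le_card_nsmul _ _ _ fun u hu => hmax u (hsame u (by simpa using hu))
      rw [nsmul_eq_mul] at hbd
      have hdeg : 2 ≤ #(univ.filter (G.Adj w)) := by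
        have : (2 : ℝ) ≤ #(univ.filter (G.Adj w)) := by
          by_contra hh
          push Not at hh
          nlinarith
        exact_mod_cast this
      have hsub : insert w (univ.filter (G.Adj w)) ⊆ univ.filter fun v => G.connectedComponentMk v = c := by
        intro u hu
        simp only [mem_insert, mem_filter, mem_univ, true_and] at hu ⊢
        rcases hu with rfl | hu
        · exact hw
        · exact hsame u hu
      have := card_le_card hsub
      rw [card_insert_of_notMem (by simp)] at this
      omega
    have hsum := card_eq_sum_card_fiberwise (f := G.connectedComponentMk) (s := univ.filter fun v => G.connectedComponentMk v ∈ C) (t := C)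
      (by intro v hv; simpa using hv)
    have hge : ∑ c ∈ C, 3 ≤ ∑ c ∈ C, #((univ.filter fun v => G.connectedComponentMk v ∈ C).filter fun v => G.connectedComponentMk v = c) := by
      refine sum_le_sum fun c hc => (hfib c hc).trans (card_le_card ?_)
      intro v hv
      simp only [mem_filter, mem_univ, true_and] at hv ⊢
      exact ⟨hv ▸ hc, hv⟩
    rw [← hsum, sum_const, smul_eq_mul] at hge
    have := card_le_univ (univ.filter fun v => G.connectedComponentMk v ∈ C)
    omega
  omega

end Part2

section Part3
open Finset

/-- every nonnegative vector with small support is fine -/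
def NoBad {V : Type*} [Fintype V] (G : SimpleGraph V) : Prop :=
  ∀ (F : Finset V) (f : V → ℝ), #F ≤ 10 → (∀ v, v ∉ F → f v = 0) → 0 ≤ qf G f

/-- `G` contains the pattern on `k` vertices with edge list `es` inside `W`. -/
def HasT {V : Type*} (G : SimpleGraph V) (W : Finset V) (k : ℕ) (es : List (ℕ × ℕ)) : Prop :=
  ∃ p : ℕ → V, (∀ i < k, ∀ j < k, p i = p j → i = j) ∧ (∀ i < k, p i ∈ W) ∧
    ∀ e ∈ es, G.Adj (p e.1) (p e.2)

lemma HasT.kill {V : Type*} [Fintype V] {G : SimpleGraph V} {W : Finset V} (hno : NoBad G)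
    {k : ℕ} {es : List (ℕ × ℕ)} (h : HasT G W k es) (w : List ℕ)
    (hk : k ≤ 10) (hnd : es.Nodup) (hes : ∀ e ∈ es, e.1 < e.2 ∧ e.2 < k)
    (hw : ∑ i ∈ range k, (w.getD i 0) ^ 2 < (es.map fun e => w.getD e.1 0 * w.getD e.2 0).sum) :
    False := by
  classical
  obtain ⟨p, hinj, -, hadj⟩ := h
  set c : ℕ → ℕ := fun i => w.getD i 0 with hc
  have hinjOn : Set.InjOn p (range k) := by
    intro i hi j hj hij
    exact hinj i (by simpa using hi) j (by simpa using hj) hij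
  set f : V → ℝ := fun v => ∑ i ∈ range k, if p i = v then (c i : ℝ) else 0 with hf
  have hfp : ∀ i ∈ range k, f (p i) = c i := by
    intro i hi
    simp only [hf]
    rw [sum_eq_single i]
    · simp
    · intro j hj hji
      rw [if_neg]
      intro hh
      exact hji (hinjOn hj hi hh)
    · intro hh; exact absurd hi hh
  set F := (range k).image p with hF
  have hf0 : ∀ v, v ∉ F → f v = 0 := by
    intro v hv
    refine sum_eq_zero fun i hi => ?_
    rw [if_neg]
    rintro rfl
    exact hv (mem_image_of_mem p hi)
  have hq := hno F f (card_image_le.trans (by simpa using hk)) hf0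
  have e1 : ∑ v, f v ^ 2 = ∑ i ∈ range k, (c i : ℝ) ^ 2 := by
    rw [← sum_subset (subset_univ F) (fun v _ hv => by rw [hf0 v hv]; simp), hF, sum_image hinjOn]
    exact sum_congr rfl fun i hi => by rw [hfp i hi]
  have e2 : ∑ u, ∑ v, ad G u v * (f u * f v) =
      ∑ i ∈ range k, ∑ j ∈ range k, ad G (p i) (p j) * ((c i : ℝ) * c j) := by
    rw [← sum_subset (subset_univ F) (fun v _ hv => by simp [hf0 v hv]), hF, sum_image hinjOn]
    refine sum_congr rfl fun i hi => ?_
    rw [← sum_subset (subset_univ F) (fun v _ hv => by simp [hf0 v hv]), hF, sum_image hinjOn]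
    exact sum_congr rfl fun j hj => by rw [hfp i hi, hfp j hj]
  have e3 : 2 * ((es.map fun e => c e.1 * c e.2).sum : ℝ) ≤
      ∑ i ∈ range k, ∑ j ∈ range k, ad G (p i) (p j) * ((c i : ℝ) * c j) := by
    set g : ℕ × ℕ → ℝ := fun e => ad G (p e.1) (p e.2) * ((c e.1 : ℝ) * c e.2) with hg
    have : ∑ i ∈ range k, ∑ j ∈ range k, ad G (p i) (p j) * ((c i : ℝ) * c j)
      = ∑ e ∈ range k ×ˢ range k, g e := by rw [sum_product]
    rw [this]
    set E := es.toFinset with hE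
    have hdis : Disjoint E (E.image Prod.swap) := by
      rw [Finset.disjoint_left]
      intro e he he'
      rw [mem_image] at he'
      obtain ⟨e', he', rfl⟩ := he'
      have a1 := hes _ (List.mem_toFinset.1 he)
      have a2 := hes _ (List.mem_toFinset.1 he')
      simp only [Prod.fst_swap, Prod.snd_swap] at a1
      omega
    have hsub : E ∪ E.image Prod.swap ⊆ range k ×ˢ range k := by
      intro e he
      rw [mem_union, mem_image] at he
      rcases he with he | ⟨e', he, rfl⟩
      · have a1 := hes _ (List.mem_toFinset.1 he)
        simp only [mem_product, mem_range]; omega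
      · have a1 := hes _ (List.mem_toFinset.1 he)
        simp only [mem_product, mem_range, Prod.fst_swap, Prod.snd_swap]; omega
    have hs1 : ∑ e ∈ E, g e = ((es.map fun e => c e.1 * c e.2).sum : ℝ) := by
      have : ((es.map fun e => c e.1 * c e.2).sum : ℝ) = (es.map g).sum := by
        rw [Nat.cast_list_sum, List.map_map]
        congr 1
        refine List.map_congr_left fun e he => ?_
        simp [hg, ad_of_adj (hadj e he)]
      rw [this, hE, List.sum_toFinset _ hnd]
    have hs2 : ∑ e ∈ E.image Prod.swap, g e = ∑ e ∈ E, g e := by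
      rw [sum_image (fun a _ b _ h => Prod.swap_injective h)]
      refine sum_congr rfl fun e _ => ?_
      simp only [hg, Prod.fst_swap, Prod.snd_swap]
      rw [ad_symm]; ring
    calc _ = ∑ e ∈ E ∪ E.image Prod.swap, g e := by rw [sum_union hdis, hs2, hs1]; ring
      _ ≤ _ := sum_le_sum_of_subset_of_nonneg hsub fun e _ _ =>
        mul_nonneg (ad_nonneg _ _ _) (by positivity)
  unfold qf at hq
  rw [e1, e2] at hq
  have hw' : (∑ i ∈ range k, (c i : ℝ) ^ 2) < ((es.map fun e => c e.1 * c e.2).sum : ℕ) := by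
    exact_mod_cast hw
  linarith

lemma HasT.permuted {V : Type*} {G : SimpleGraph V} {W : Finset V}
    {k : ℕ} {es es' : List (ℕ × ℕ)} (h : HasT G W k es) (s : List ℕ)
    (h1 : ∀ i < k, s.getD i 0 < k) (h2 : ∀ i < k, ∀ j < k, s.getD i 0 = s.getD j 0 → i = j)
    (h3 : ∀ e ∈ es', (s.getD e.1 0, s.getD e.2 0) ∈ es) : HasT G W k es' := by
  obtain ⟨p, hinj, hW, hadj⟩ := h
  exact ⟨fun i => p (s.getD i 0), fun i hi j hj hij => h2 i hi j hj (hinj _ (h1 i hi) _ (h1 j hj) hij),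
    fun i hi => hW _ (h1 i hi), fun e he => hadj _ (h3 e he)⟩

/-- connectedness of `W` -/
def Conn {V : Type*} (G : SimpleGraph V) (W : Finset V) : Prop :=
  ∀ T ⊆ W, T.Nonempty → T ≠ W → ∃ t ∈ T, ∃ y ∈ W, y ∉ T ∧ G.Adj t y

lemma HasT.grow {V : Type*} {G : SimpleGraph V} {W : Finset V} (hconn : Conn G W)
    {k : ℕ} {es : List (ℕ × ℕ)} (h : HasT G W k es) (hk : 0 < k) (hkW : k < #W)
    (hes : ∀ e ∈ es, e.1 < e.2 ∧ e.2 < k) :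
    ∃ t < k, HasT G W (k + 1) ((t, k) :: es) := by
  classical
  obtain ⟨p, hinj, hW, hadj⟩ := h
  have hcard : #((range k).image p) ≤ k := card_image_le.trans (by simp)
  obtain ⟨t, ht, y, hy, hyT, hty⟩ := hconn ((range k).image p)
    (by intro v hv; rw [mem_image] at hv; obtain ⟨i, hi, rfl⟩ := hv; exact hW i (by simpa using hi))
    ⟨p 0, mem_image_of_mem p (by simpa using hk)⟩ (by rintro hh; rw [hh] at hcard; omega)
  rw [mem_image] at ht
  obtain ⟨i, hi, rfl⟩ := ht
  have hik : i < k := by simpa using hi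
  have hyp : ∀ j < k, p j ≠ y := by
    rintro j hj rfl
    exact hyT (mem_image_of_mem p (by simpa using hj))
  refine ⟨i, hik, Function.update p k y, ?_, ?_, ?_⟩
  · intro a ha b hb hab
    by_cases ha' : a = k <;> by_cases hb' : b = k
    · omega
    · subst ha'
      rw [Function.update_self, Function.update_of_ne hb'] at hab
      exact absurd hab.symm (hyp b (by omega))
    · subst hb'
      rw [Function.update_self, Function.update_of_ne ha'] at hab
      exact absurd hab (hyp a (by omega))
    · rw [Function.update_of_ne hb', Function.update_of_ne ha'] at hab
      exact hinj a (by omega) b (by omega) hab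
  · intro a ha
    by_cases ha' : a = k
    · subst ha'; simpa using hy
    · rw [Function.update_of_ne ha']; exact hW a (by omega)
  · intro e he
    rw [List.mem_cons] at he
    rcases he with rfl | he
    · simp only [Function.update_self]
      rw [Function.update_of_ne (by omega)]; exact hty
    · have := hes e he
      rw [Function.update_of_ne (by omega), Function.update_of_ne (by omega)]; exact hadj e he

lemma HasT.of_list {V : Type*} {G : SimpleGraph V} {W : Finset V} (d : V) (l : List V) (hl : l.Nodup)
    (hW : ∀ v ∈ l, v ∈ W) (es : List (ℕ × ℕ)) (h : ∀ e ∈ es, G.Adj (l.getD e.1 d) (l.getD e.2 d)) :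
    HasT G W l.length es := by
  refine ⟨fun i => l.getD i d, ?_, ?_, h⟩
  · intro i hi j hj hij
    simp only [List.getD_eq_getElem _ _ hi, List.getD_eq_getElem _ _ hj] at hij
    exact (List.Nodup.getElem_inj_iff hl).1 hij
  · intro i hi
    simp only [List.getD_eq_getElem _ _ hi]
    exact hW _ (List.getElem_mem hi)

lemma no_T122 {V : Type*} [Fintype V] {G : SimpleGraph V} {W : Finset V} (hno : NoBad G)
    (hconn : Conn G W) (hW : 11 ≤ #W)
    (h : HasT G W 6 [(0,1),(0,2),(0,3),(2,4),(3,5)]) : False := by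
  have h123 : HasT G W 7 [(4,6),(0,1),(0,2),(0,3),(2,4),(3,5)] → False := by
    intro h
    obtain ⟨t, ht, h⟩ := h.grow hconn (by norm_num) (by omega) (by decide)
    interval_cases t
    · exact h.kill hno [4,2,2,2,1,0,0,2] (by norm_num) (by decide) (by decide) (by decide)
    · exact h.kill hno [6,4,4,4,2,2,1,2] (by norm_num) (by decide) (by decide) (by decide)
    · exact h.kill hno [4,2,4,2,2,1,0,2] (by norm_num) (by decide) (by decide) (by decide)
    · exact h.kill hno [4,2,2,4,1,2,0,2] (by norm_num) (by decide) (by decide) (by decide)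
    · exact h.kill hno [4,2,4,2,4,1,2,2] (by norm_num) (by decide) (by decide) (by decide)
    · obtain ⟨t, ht, h⟩ := h.grow hconn (by norm_num) (by omega) (by decide)
      interval_cases t <;>
      exact h.kill hno [8,4,6,6,4,4,2,2,1] (by norm_num) (by decide) (by decide) (by decide)
    · obtain ⟨t, ht, h⟩ := h.grow hconn (by norm_num) (by omega) (by decide)
      interval_cases t
      · exact h.kill hno [4,2,2,2,1,0,0,0,2] (by norm_num) (by decide) (by decide) (by decide)
      · exact h.kill hno [6,4,4,4,2,2,1,0,2] (by norm_num) (by decide) (by decide) (by decide)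
      · exact h.kill hno [4,2,4,2,2,1,0,0,2] (by norm_num) (by decide) (by decide) (by decide)
      · exact h.kill hno [4,2,2,4,1,2,0,0,2] (by norm_num) (by decide) (by decide) (by decide)
      · exact h.kill hno [4,2,4,2,4,1,2,0,2] (by norm_num) (by decide) (by decide) (by decide)
      · exact h.kill hno [8,4,6,6,4,4,2,1,2] (by norm_num) (by decide) (by decide) (by decide)
      · exact h.kill hno [4,2,4,2,4,1,4,2,2] (by norm_num) (by decide) (by decide) (by decide)
      · obtain ⟨t, ht, h⟩ := h.grow hconn (by norm_num) (by omega) (by decide)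
        interval_cases t <;>
        exact h.kill hno [12,6,10,8,8,4,6,4,2,1] (by norm_num) (by decide) (by decide) (by decide)
  obtain ⟨t, ht, h⟩ := h.grow hconn (by norm_num) (by omega) (by decide)
  interval_cases t
  · exact h.kill hno [4,2,2,2,1,0,2] (by norm_num) (by decide) (by decide) (by decide)
  · obtain ⟨t, ht, h⟩ := h.grow hconn (by norm_num) (by omega) (by decide)
    interval_cases t <;>
    exact h.kill hno [6,4,4,4,2,2,2,1] (by norm_num) (by decide) (by decide) (by decide)
  · exact h.kill hno [4,2,4,2,2,1,2] (by norm_num) (by decide) (by decide) (by decide)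
  · exact h.kill hno [4,2,2,4,1,2,2] (by norm_num) (by decide) (by decide) (by decide)
  · exact h123 h
  · exact h123 (h.permuted [0,1,3,2,5,4,6] (by decide) (by decide) (by decide))

end Part3

section Part4
open Finset

lemma superharm {V : Type*} [Fintype V] [DecidableEq V] (G : SimpleGraph V) [DecidableRel G.Adj]
    (W : Finset V) (h f : V → ℝ)
    (hpos : ∀ v, 0 < h v) (hsup : ∀ v ∈ W, ∑ u ∈ W.filter (G.Adj v), h u ≤ 2 * h v)
    (hf : ∀ v, v ∉ W → f v = 0) : 0 ≤ qf G f := by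
  have hsup' : ∀ v ∈ W, ∑ u ∈ W, ad G v u * h u ≤ 2 * h v := by
    intro v hv
    refine le_trans (le_of_eq ?_) (hsup v hv)
    rw [sum_filter]
    refine sum_congr rfl fun u _ => ?_
    by_cases hh : G.Adj v u <;> simp [ad, hh]
  have e1 : ∑ v, f v ^ 2 = ∑ v ∈ W, f v ^ 2 := by
    rw [← sum_subset (subset_univ W) (fun v _ hv => by simp [hf v hv])]
  have e2 : ∑ u, ∑ v, ad G u v * (f u * f v) = ∑ u ∈ W, ∑ v ∈ W, ad G u v * (f u * f v) := by
    rw [← sum_subset (subset_univ W) (fun v _ hv => by simp [hf v hv])]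
    refine sum_congr rfl fun u _ => ?_
    rw [← sum_subset (subset_univ W) (fun v _ hv => by simp [hf v hv])]
  have e3 : ∑ u ∈ W, ∑ v ∈ W, ad G u v * (f u * f v) ≤
      ∑ u ∈ W, ∑ v ∈ W, ad G u v * (f u ^ 2 * h v / h u) := by
    have sw : ∑ u ∈ W, ∑ v ∈ W, ad G u v * (f v ^ 2 * h u / h v) =
        ∑ u ∈ W, ∑ v ∈ W, ad G u v * (f u ^ 2 * h v / h u) := by
      rw [sum_comm]
      refine sum_congr rfl fun u _ => sum_congr rfl fun v _ => ?_
      rw [ad_symm]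
    have : ∑ u ∈ W, ∑ v ∈ W, 2 * (ad G u v * (f u * f v)) ≤
        ∑ u ∈ W, ∑ v ∈ W, (ad G u v * (f u ^ 2 * h v / h u) + ad G u v * (f v ^ 2 * h u / h v)) := by
      refine sum_le_sum fun u _ => sum_le_sum fun v _ => ?_
      have hu := hpos u
      have hv := hpos v
      have key : 2 * (f u * f v) ≤ f u ^ 2 * h v / h u + f v ^ 2 * h u / h v := by
        rw [div_add_div _ _ hu.ne' hv.ne', le_div_iff₀ (by positivity)]
        nlinarith [sq_nonneg (f u * h v - f v * h u)]
      have := mul_le_mul_of_nonneg_left key (ad_nonneg G u v)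
      linarith
    simp only [sum_add_distrib, ← mul_sum] at this
    rw [sw] at this
    linarith
  have e4 : ∑ u ∈ W, ∑ v ∈ W, ad G u v * (f u ^ 2 * h v / h u) ≤ ∑ u ∈ W, 2 * f u ^ 2 := by
    refine sum_le_sum fun u hu => ?_
    have : ∑ v ∈ W, ad G u v * (f u ^ 2 * h v / h u) = f u ^ 2 / h u * ∑ v ∈ W, ad G u v * h v := by
      rw [mul_sum]; exact sum_congr rfl fun v _ => by ring
    rw [this]
    have hp := hpos u
    calc _ ≤ f u ^ 2 / h u * (2 * h u) := mul_le_mul_of_nonneg_left (hsup' u hu) (by positivity)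
      _ = 2 * f u ^ 2 := by field_simp
  unfold qf
  rw [e1, e2]
  rw [← mul_sum] at e4
  linarith

lemma exists_conn {V : Type*} [Fintype V] (G : SimpleGraph V) (x : V → ℝ) (hx : qf G x < 0) :
    ∃ (W : Finset V) (f : V → ℝ), (∀ v, v ∉ W → f v = 0) ∧ qf G f < 0 ∧ Conn G W := by
  classical
  let P : Finset (Finset V) := univ.filter fun W => ∃ f : V → ℝ, (∀ v, v ∉ W → f v = 0) ∧ qf G f < 0
  obtain ⟨W, hW, hmin⟩ := exists_min_image P card ⟨univ, by
    simp only [P, mem_filter, mem_univ, true_and]; exact ⟨x, by simp, hx⟩⟩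
  have hmin' : ∀ (W' : Finset V) (f : V → ℝ), (∀ v, v ∉ W' → f v = 0) → qf G f < 0 → #W ≤ #W' := by
    intro W' f h1 h2
    apply hmin
    simp only [P, mem_filter, mem_univ, true_and]; exact ⟨f, h1, h2⟩
  simp only [P, mem_filter, mem_univ, true_and] at hW
  obtain ⟨f, hf, hq⟩ := hW
  refine ⟨W, f, hf, hq, ?_⟩
  intro T hT hne hTW
  by_contra hcon
  push Not at hcon
  set g1 : V → ℝ := fun v => if v ∈ T then f v else 0 with hg1
  set g2 : V → ℝ := fun v => if v ∈ T then 0 else f v with hg2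
  have hfe : f = fun v => 1 * g1 v + 1 * g2 v := by
    funext v; by_cases h : v ∈ T <;> simp [hg1, hg2, h]
  have hc := qf_comb G g1 g2 1 1
  rw [← hfe] at hc
  have z1 : ∑ v, g1 v * g2 v = 0 := sum_eq_zero fun v _ => by
    by_cases h : v ∈ T <;> simp [hg1, hg2, h]
  have z2 : ∑ u, ∑ v, ad G u v * (g1 u * g2 v) = 0 := sum_eq_zero fun u _ => sum_eq_zero fun v _ => by
    by_cases hu : u ∈ T
    · by_cases hv : v ∈ T
      · simp [hg2, hv]
      · by_cases hvW : v ∈ W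
        · rw [ad_of_not (hcon u hu v hvW hv)]; simp
        · simp [hg2, hf v hvW]
    · simp [hg1, hu]
  rw [z1, z2] at hc
  have hlt : #T < #W := card_lt_card (hT.ssubset_of_ne hTW)
  have hlt2 : #(W \ T) < #W := by
    apply card_lt_card
    refine (sdiff_subset).ssubset_of_ne ?_
    intro hh
    obtain ⟨t, ht⟩ := hne
    have h5 : t ∈ W := hT ht
    rw [← hh] at h5
    simp [ht] at h5
  rcases lt_or_ge (qf G g1) 0 with h1 | h1
  · have := hmin' T g1 (fun v hv => by simp [hg1, hv]) h1
    omega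
  rcases lt_or_ge (qf G g2) 0 with h2 | h2
  · have := hmin' (W \ T) g2 (fun v hv => by
      by_cases hvT : v ∈ T
      · simp [hg2, hvT]
      · have : v ∉ W := by intro hh; exact hv (by simp [hh, hvT])
        simp [hg2, hf v this]) h2
    omega
  linarith

theorem smith {V : Type*} [Fintype V] (G : SimpleGraph V) (x : V → ℝ) (hx : qf G x < 0) :
    ¬ NoBad G := by
  classical
  intro hno
  obtain ⟨W, f, hf, hq, hconn⟩ := exists_conn G x hx
  have hW : 11 ≤ #W := by
    by_contra hh
    exact absurd (hno W f (by omega) hf) (by linarith)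
  refine absurd ?_ (not_le.2 hq)
  set N : V → Finset V := fun v => W.filter (G.Adj v) with hN
  set h : V → ℝ := fun v => if #(N v) ≤ 1 then 1/2 else 1 with hh
  have hle1 : ∀ v, h v ≤ 1 := by intro v; simp only [hh]; split_ifs <;> norm_num
  have mN : ∀ {u v}, u ∈ N v ↔ u ∈ W ∧ G.Adj v u := by intro u v; simp [hN]
  -- triangle with pendant
  have ktri : ∀ v a b c, v ∈ W → a ∈ W → b ∈ W → c ∈ W → G.Adj v a → G.Adj v b → G.Adj a b →
      G.Adj v c → c ≠ a → c ≠ b → False := by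
    intro v a b c hv ha hb hc e1 e2 e3 e4 n1 n2
    have : HasT G W 4 _ := HasT.of_list (G := G) (W := W) v [v, a, b, c]
      (by simp [e1.ne, e2.ne, e3.ne, e4.ne, n1.symm, n2.symm])
      (by simp [hv, ha, hb, hc]) [(0,1),(0,2),(1,2),(0,3)] (by simp [e1, e2, e3, e4])
    exact this.kill hno [2,2,2,1] (by norm_num) (by decide) (by decide) (by decide)
  have nonleaf : ∀ v u, v ∈ W → G.Adj v u → ¬ #(N u) ≤ 1 → ∃ u' ∈ W, G.Adj u u' ∧ u' ≠ v := by
    intro v u hv hadj hc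
    have h2 : 1 < #(N u) := by omega
    obtain ⟨u', hu', hne⟩ := exists_mem_ne h2 v
    rw [mN] at hu'
    exact ⟨u', hu'.1, hu'.2, hne⟩
  apply superharm G W h f (by intro v; simp only [hh]; split_ifs <;> norm_num) ?_ hf
  intro v hv
  change ∑ u ∈ N v, h u ≤ 2 * h v
  have hb1 : ∑ u ∈ N v, h u ≤ #(N v) := by
    have := sum_le_card_nsmul (N v) h 1 (fun u _ => hle1 u)
    simpa using this
  have htwo : 2 ≤ #(N v) → h v = 1 := by intro h2; simp only [hh]; rw [if_neg (by omega)]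
  rcases le_or_gt (#(N v)) 1 with h1 | h1
  · have hv1 : h v = 1/2 := by simp only [hh]; rw [if_pos h1]
    have : (#(N v) : ℝ) ≤ 1 := by exact_mod_cast h1
    linarith
  rw [htwo h1]
  rcases Nat.lt_or_ge (#(N v)) 3 with h3 | h3
  · have : (#(N v) : ℝ) ≤ 2 := by exact_mod_cast (by omega : #(N v) ≤ 2)
    linarith
  rcases Nat.lt_or_ge (#(N v)) 5 with h5 | h5
  swap
  · exfalso
    obtain ⟨T, hT, hTc⟩ := exists_subset_card_eq h5
    have hl : T.toList.length = 5 := by simpa using hTc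
    have := HasT.of_list (G := G) (W := W) v (v :: T.toList)
      (by
        rw [List.nodup_cons]
        refine ⟨?_, T.nodup_toList⟩
        rw [mem_toList]
        intro hvT
        exact G.loopless.irrefl v (mN.1 (hT hvT)).2)
      (by
        intro u hu
        rw [List.mem_cons, mem_toList] at hu
        rcases hu with rfl | hu
        · exact hv
        · exact (mN.1 (hT hu)).1)
      [(0,1),(0,2),(0,3),(0,4),(0,5)]
      (by
        have key : ∀ i < 5, G.Adj v (T.toList.getD i v) := by
          intro i hi
          rw [List.getD_eq_getElem _ _ (by omega)]
          exact (mN.1 (hT (mem_toList.1 (List.getElem_mem _)))).2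
        intro e he
        simp only [List.mem_cons, List.not_mem_nil, or_false] at he
        rcases he with rfl | rfl | rfl | rfl | rfl
        · exact key 0 (by norm_num)
        · exact key 1 (by norm_num)
        · exact key 2 (by norm_num)
        · exact key 3 (by norm_num)
        · exact key 4 (by norm_num))
    rw [List.length_cons, hl] at this
    exact this.kill hno [2,1,1,1,1,1] (by norm_num) (by decide) (by decide) (by decide)
  by_cases h4 : #(N v) = 4
  · -- all neighbours are leaves
    have hleaf : ∀ u ∈ N v, h u ≤ 1/2 := by
      intro u hu
      by_contra hcon
      have hc : ¬ #(N u) ≤ 1 := by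
        intro hc; apply hcon; simp only [hh]; rw [if_pos hc]
      obtain ⟨huW, huv⟩ := mN.1 hu
      obtain ⟨u', hu'W, huu', hu'v⟩ := nonleaf v u hv huv hc
      have hcard : #((N v).erase u) = 3 := by rw [card_erase_of_mem hu, h4]
      obtain ⟨a, b, c, hab, hac, hbc, hset⟩ := card_eq_three.1 hcard
      have ma : a ∈ (N v).erase u := by rw [hset]; simp
      have mb : b ∈ (N v).erase u := by rw [hset]; simp
      have mc : c ∈ (N v).erase u := by rw [hset]; simp
      rw [mem_erase, mN] at ma mb mc
      by_cases hmem : G.Adj v u'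
      · have hex : ∃ z ∈ W, G.Adj v z ∧ z ≠ u ∧ z ≠ u' := by
          by_cases hz : a = u'
          · exact ⟨b, mb.2.1, mb.2.2, mb.1, by rintro rfl; exact hab hz⟩
          · exact ⟨a, ma.2.1, ma.2.2, ma.1, hz⟩
        obtain ⟨z, hzW, hz1, hz2, hz3⟩ := hex
        exact ktri v u u' z hv huW hu'W hzW huv hmem huu' hz1 hz2 hz3
      · have na : a ≠ u' := by rintro rfl; exact hmem ma.2.2
        have nb : b ≠ u' := by rintro rfl; exact hmem mb.2.2
        have nc : c ≠ u' := by rintro rfl; exact hmem mc.2.2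
        have : HasT G W 6 _ := HasT.of_list (G := G) (W := W) v [v, u, a, b, c, u']
          (by simp [huv.ne, ma.2.2.ne, mb.2.2.ne, mc.2.2.ne, ma.1.symm, mb.1.symm, mc.1.symm,
                hab, hac, hbc, na, nb, nc, huu'.ne, hu'v.symm])
          (by simp [hv, huW, ma.2.1, mb.2.1, mc.2.1, hu'W]) [(0,1),(0,2),(0,3),(0,4),(1,5)]
          (by simp [huv, ma.2.2, mb.2.2, mc.2.2, huu'])
        exact this.kill hno [4,2,2,2,2,1] (by norm_num) (by decide) (by decide) (by decide)
    have := sum_le_card_nsmul (N v) h (1/2) hleaf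
    rw [h4] at this
    norm_num at this
    linarith
  have h3' : #(N v) = 3 := by omega
  -- two nonleaf neighbours are impossible
  have two : ∀ a b c, a ∈ N v → b ∈ N v → c ∈ N v → a ≠ b → a ≠ c → b ≠ c →
      ¬ #(N b) ≤ 1 → ¬ #(N c) ≤ 1 → False := by
    intro a b c ha hb hc hab hac hbc lb lc
    rw [mN] at ha hb hc
    obtain ⟨b', hb'W, hbb', hb'v⟩ := nonleaf v b hv hb.2 lb
    obtain ⟨c', hc'W, hcc', hc'v⟩ := nonleaf v c hv hc.2 lc
    by_cases q1 : G.Adj b c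
    · exact ktri v b c a hv hb.1 hc.1 ha.1 hb.2 hc.2 q1 ha.2 hab hac
    by_cases q2 : G.Adj b a
    · exact ktri v b a c hv hb.1 ha.1 hc.1 hb.2 ha.2 q2 hc.2 hbc.symm hac.symm
    by_cases q3 : G.Adj c a
    · exact ktri v c a b hv hc.1 ha.1 hb.1 hc.2 ha.2 q3 hb.2 hbc hab.symm
    have n1 : a ≠ b' := by rintro rfl; exact q2 hbb'
    have n2 : a ≠ c' := by rintro rfl; exact q3 hcc'
    have n3 : c ≠ b' := by rintro rfl; exact q1 hbb'
    have n4 : b ≠ c' := by rintro rfl; exact q1 hcc'.symm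
    by_cases q4 : b' = c'
    · subst q4
      have : HasT G W 5 _ := HasT.of_list (G := G) (W := W) v [v, b, c, b', a]
        (by simp [hb.2.ne, hc.2.ne, hb'v.symm, ha.2.ne, hbc, hbb'.ne, hab.symm, hcc'.ne, hac.symm, n1.symm])
        (by simp [hv, ha.1, hb.1, hc.1, hb'W]) [(0,1),(0,2),(1,3),(2,3),(0,4)]
        (by simp [ha.2, hb.2, hc.2, hbb', hcc'])
      exact this.kill hno [2,2,2,2,1] (by norm_num) (by decide) (by decide) (by decide)
    · have : HasT G W 6 _ := HasT.of_list (G := G) (W := W) v [v, a, b, c, b', c']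
        (by simp [hb.2.ne, hc.2.ne, hb'v.symm, hc'v.symm, ha.2.ne, hbc, hbb'.ne, hab, hcc'.ne, hac, n1, n2, n3, n4, q4])
        (by simp [hv, ha.1, hb.1, hc.1, hb'W, hc'W]) [(0,1),(0,2),(0,3),(2,4),(3,5)]
        (by simp [ha.2, hb.2, hc.2, hbb', hcc'])
      exact no_T122 hno hconn hW this
  obtain ⟨a, b, c, hab, hac, hbc, hset⟩ := card_eq_three.1 h3'
  have ma : a ∈ N v := by rw [hset]; simp
  have mb : b ∈ N v := by rw [hset]; simp
  have mc : c ∈ N v := by rw [hset]; simp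
  have hsum : ∑ u ∈ N v, h u = h a + h b + h c := by
    rw [hset, sum_insert (by simp [hab, hac]), sum_pair hbc]; ring
  have hv1 : ∀ u, #(N u) ≤ 1 → h u = 1/2 := by intro u hu; simp only [hh]; rw [if_pos hu]
  rw [hsum]
  have := hle1 a
  have := hle1 b
  have := hle1 c
  by_cases la : #(N a) ≤ 1 <;> by_cases lb : #(N b) ≤ 1 <;> by_cases lc : #(N c) ≤ 1
  all_goals first
    | (rw [hv1 a la, hv1 b lb]; linarith)
    | (rw [hv1 a la, hv1 c lc]; linarith)
    | (rw [hv1 b lb, hv1 c lc]; linarith)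
    | exact (two a b c ma mb mc hab hac hbc lb lc).elim
    | exact (two b a c mb ma mc hab.symm hbc hac la lc).elim
    | exact (two c a b mc ma mb hac.symm hbc.symm hab la lb).elim

end Part4

section Part5
open Finset

open scoped Classical in
/-- neighbours in `I` -/
noncomputable def NI {V : Type*} (G : SimpleGraph V) (I : Finset V) (v : V) : Finset V :=
  I.filter (G.Adj v)

open scoped Classical in
/-- neighbours outside `I` -/
noncomputable def NX {V : Type*} [Fintype V] (G : SimpleGraph V) (I : Finset V) (v : V) : Finset V :=
  univ.filter (fun y => y ∉ I ∧ G.Adj v y)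

lemma mem_NI {V : Type*} {G : SimpleGraph V} {I : Finset V} {v u : V} :
    u ∈ NI G I v ↔ u ∈ I ∧ G.Adj v u := by simp [NI]

lemma mem_NX {V : Type*} [Fintype V] {G : SimpleGraph V} {I : Finset V} {v u : V} :
    u ∈ NX G I v ↔ u ∉ I ∧ G.Adj v u := by simp [NX]

lemma dg_eq {V : Type*} [Fintype V] (G : SimpleGraph V) (I : Finset V) (v : V) :
    dg G v = #(NI G I v) + #(NX G I v) := by
  classical
  unfold dg
  rw [← card_union_of_disjoint]
  · congr 1
    ext u
    simp only [mem_filter, mem_univ, true_and, mem_union, mem_NI, mem_NX]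
    tauto
  · rw [Finset.disjoint_left]
    intro u hu hu'
    rw [mem_NI] at hu
    rw [mem_NX] at hu'
    exact hu'.1 hu.1

lemma sum_ad_I {V : Type*} (G : SimpleGraph V) (I : Finset V) (v : V) :
    ∑ i ∈ I, ad G i v = #(NI G I v) := by
  classical
  unfold NI
  rw [card_filter]
  push_cast
  refine sum_congr rfl fun i _ => ?_
  rw [ad_symm]
  by_cases h : G.Adj v i <;> simp [ad, h]

/-- hypotheses: PSD and an independent set of size 39 -/
structure Setup {V : Type*} [Fintype V] (G : SimpleGraph V) (I : Finset V) : Prop where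
  psd : ∀ x : V → ℝ, 0 ≤ qf G x + (∑ v, x v) ^ 2
  card : #I = 39
  indep : ∀ i ∈ I, ∀ j ∈ I, ¬ G.Adj i j
  low : ∀ x, x ∉ I → #(NI G I x) ≤ 19

variable {V : Type*} [Fintype V] {G : SimpleGraph V} {I : Finset V}

lemma Setup.loc (H : Setup G I) (b : V → ℝ) (hb : ∀ i ∈ I, b i = 0) :
    0 ≤ qf G b - ∑ i ∈ I, (∑ y, ad G i y * b y) ^ 2
      + (∑ y, b y * ((#(NI G I y) : ℝ) + 2)) ^ 2 / 43 := by
  classical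
  set c : V → ℝ := fun i => ∑ y, ad G i y * b y with hc
  set P := ∑ y, b y * ((#(NI G I y) : ℝ) + 2) with hP
  set τ := P / 86 with hτ
  set u : V → ℝ := fun v => if v ∈ I then c v / 2 - τ else 0 with hu
  have huI : ∀ v ∈ I, u v = c v / 2 - τ := fun v hv => by simp [hu, hv]
  have hu0 : ∀ v, v ∉ I → u v = 0 := fun v hv => by simp [hu, hv]
  have h := H.psd (fun v => 1 * b v + 1 * u v)
  rw [qf_comb] at h
  have z1 : ∑ v, b v * u v = 0 := sum_eq_zero fun v _ => by
    by_cases hv : v ∈ I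
    · simp [hb v hv]
    · simp [hu0 v hv]
  have z2 : ∑ v, ∑ w, ad G v w * (b v * u w) = ∑ w ∈ I, c w * (c w / 2 - τ) := by
    rw [sum_comm, ← sum_subset (subset_univ I) (fun v _ hv => by simp [hu0 v hv])]
    refine sum_congr rfl fun w hw => ?_
    rw [hc, ← huI w hw, sum_mul]
    refine sum_congr rfl fun v _ => ?_
    rw [ad_symm]; ring
  have z3 : qf G u = 4 * ∑ w ∈ I, (c w / 2 - τ) ^ 2 := by
    unfold qf
    have : ∑ v, ∑ w, ad G v w * (u v * u w) = 0 := sum_eq_zero fun v _ => sum_eq_zero fun w _ => by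
      by_cases hv : v ∈ I
      · by_cases hw : w ∈ I
        · rw [ad_of_not (H.indep v hv w hw)]; simp
        · simp [hu0 w hw]
      · simp [hu0 v hv]
    rw [this, ← sum_subset (subset_univ I) (fun v _ hv => by simp [hu0 v hv])]
    rw [mul_zero, sub_zero]
    congr 1
    exact sum_congr rfl fun w hw => by rw [huI w hw]
  have z4 : ∑ v, (1 * b v + 1 * u v) = ∑ v, b v + ∑ w ∈ I, (c w / 2 - τ) := by
    simp only [one_mul, sum_add_distrib]
    congr 1
    rw [← sum_subset (subset_univ I) (fun v _ hv => by simp [hu0 v hv])]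
    exact sum_congr rfl fun w hw => by rw [huI w hw]
  have z5 : ∑ w ∈ I, c w = ∑ y, b y * (#(NI G I y) : ℝ) := by
    rw [hc, sum_comm]
    refine sum_congr rfl fun y _ => ?_
    rw [← sum_ad_I, mul_sum]
    exact sum_congr rfl fun i _ => by ring
  have z6 : P = ∑ w ∈ I, c w + 2 * ∑ v, b v := by
    rw [z5, hP, mul_sum, ← sum_add_distrib]
    exact sum_congr rfl fun i _ => by ring
  have z7 : ∑ w ∈ I, (c w / 2 - τ) = (∑ w ∈ I, c w) / 2 - 39 * τ := by
    rw [sum_sub_distrib, sum_const, H.card, ← sum_div]; norm_num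
  have z8 : 4 * ∑ w ∈ I, (c w / 2 - τ) ^ 2 - 4 * ∑ w ∈ I, c w * (c w / 2 - τ) =
      - ∑ w ∈ I, c w ^ 2 + 156 * τ ^ 2 := by
    have : ∑ w ∈ I, (4 * τ ^ 2) = 156 * τ ^ 2 := by rw [sum_const, H.card, nsmul_eq_mul]; norm_num; ring
    rw [← this, mul_sum, mul_sum, ← sum_sub_distrib, ← sum_neg_distrib, ← sum_add_distrib]
    exact sum_congr rfl fun i _ => by ring
  rw [z1, z2, z3, z4, z7] at h
  have hC : ∑ w ∈ I, c w = P - 2 * ∑ v, b v := by linarith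
  rw [hC] at h
  have e : ∑ v, b v + ((P - 2 * ∑ v, b v) / 2 - 39 * τ) = P / 2 - 39 * τ := by ring
  rw [e] at h
  have e2 : (P / 2 - 39 * τ) ^ 2 + 156 * τ ^ 2 = P ^ 2 / 43 := by rw [hτ]; ring
  linarith

lemma sum_ite_mul_mem [DecidableEq V] (T : Finset V) (g : V → ℝ) :
    ∑ y, g y * (if y ∈ T then (1:ℝ) else 0) = ∑ y ∈ T, g y := by
  simp

lemma qf_ind [DecidableEq V] (G : SimpleGraph V) (T : Finset V) :
    qf G (fun y => if y ∈ T then (1:ℝ) else 0) = 4 * #T - 2 * ∑ u ∈ T, ∑ v ∈ T, ad G u v := by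
  unfold qf
  congr 2
  · simp
  · rw [← sum_subset (subset_univ T) (fun v _ hv => by simp [hv])]
    refine sum_congr rfl fun u hu => ?_
    rw [← sum_subset (subset_univ T) (fun v _ hv => by simp [hv])]
    exact sum_congr rfl fun v hv => by simp [hu, hv]

lemma Setup.ind (H : Setup G I) (T : Finset V) (hT : ∀ y ∈ T, y ∉ I) :
    0 ≤ 4 * (#T : ℝ) - 2 * ∑ u ∈ T, ∑ v ∈ T, ad G u v - ∑ i ∈ I, (∑ y ∈ T, ad G i y) ^ 2
      + (∑ y ∈ T, ((#(NI G I y) : ℝ) + 2)) ^ 2 / 43 := by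
  classical
  have h := H.loc (fun y => if y ∈ T then (1:ℝ) else 0)
    (fun i hi => if_neg fun hh => hT i hh hi)
  rw [qf_ind] at h
  simp only [sum_ite_mul_mem] at h
  have e : ∑ y, (if y ∈ T then (1:ℝ) else 0) * ((#(NI G I y) : ℝ) + 2) = ∑ y ∈ T, ((#(NI G I y) : ℝ) + 2) := by
    simp
  rw [e] at h
  exact h

lemma qf_star [DecidableEq V] (G : SimpleGraph V) (z : V) (T : Finset V) (hT : ∀ y ∈ T, G.Adj z y) (c : ℝ) :
    qf G (fun v => c * (if v ∈ ({z} : Finset V) then (1:ℝ) else 0) + 1 * (if v ∈ T then (1:ℝ) else 0))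
      ≤ 4 * c ^ 2 + 4 * #T - 4 * c * #T := by
  have hz : z ∉ T := fun h => G.loopless.irrefl z (hT z h)
  rw [qf_comb, qf_ind, qf_ind]
  have e1 : ∑ v, (if v ∈ ({z} : Finset V) then (1:ℝ) else 0) * (if v ∈ T then (1:ℝ) else 0) = 0 := by
    refine sum_eq_zero fun v _ => ?_
    by_cases h : v = z
    · subst h; simp [hz]
    · simp [h]
  have e2 : ∑ u, ∑ v, ad G u v * ((if u ∈ ({z} : Finset V) then (1:ℝ) else 0) * (if v ∈ T then (1:ℝ) else 0)) = #T := by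
    rw [sum_eq_single z]
    · simp only [mem_singleton, if_true, one_mul, sum_ite_mul_mem]
      rw [sum_congr rfl fun y hy => ad_of_adj (hT y hy)]; simp
    · intro u _ hu; simp [hu]
    · simp
  have e3 : 0 ≤ ∑ u ∈ T, ∑ v ∈ T, ad G u v := sum_nonneg fun u _ => sum_nonneg fun v _ => ad_nonneg _ _ _
  have e4 : ∑ u ∈ ({z} : Finset V), ∑ v ∈ ({z} : Finset V), ad G u v = 0 := by
    simp [ad]
  rw [e1, e2, e4]
  simp only [card_singleton]
  push_cast
  nlinarith

lemma sum_ad_le_sq (T : Finset V) (i : V) : ∑ y ∈ T, ad G i y ≤ (∑ y ∈ T, ad G i y) ^ 2 := by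
  have := sum_sq_le_sq_sum_of_nonneg (s := T) (f := fun y => ad G i y) (fun y _ => ad_nonneg _ _ _)
  simp only [ad_sq] at this
  exact this

lemma Setup.star (H : Setup G I) (z : V) (hzI : z ∉ I) (T : Finset V) (hT : T ⊆ NX G I z)
    (c : ℝ) (hc : 0 ≤ c) :
    0 ≤ 4 * c ^ 2 + 4 * #T - 4 * c * #T - c ^ 2 * #(NI G I z) - ∑ y ∈ T, (#(NI G I y) : ℝ)
      + (c * ((#(NI G I z) : ℝ) + 2) + ∑ y ∈ T, ((#(NI G I y) : ℝ) + 2)) ^ 2 / 43 := by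
  classical
  have hTI : ∀ y ∈ T, y ∉ I := fun y hy => (mem_NX.1 (hT hy)).1
  have hTA : ∀ y ∈ T, G.Adj z y := fun y hy => (mem_NX.1 (hT hy)).2
  have h := H.loc (fun v => c * (if v ∈ ({z} : Finset V) then (1:ℝ) else 0) + 1 * (if v ∈ T then (1:ℝ) else 0))
    (fun i hi => by
      have h1 : i ≠ z := by rintro rfl; exact hzI hi
      have h2 : i ∉ T := fun hh => hTI i hh hi
      simp [h1, h2])
  have hq := qf_star G z T hTA c
  have e1 : ∀ g : V → ℝ, ∑ y, g y * (c * (if y ∈ ({z} : Finset V) then (1:ℝ) else 0) + 1 * (if y ∈ T then (1:ℝ) else 0))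
      = c * g z + ∑ y ∈ T, g y := by
    intro g
    rw [← sum_ite_mul_mem T g]
    simp only [mul_add, sum_add_distrib, one_mul]
    congr 1
    simp [mul_comm]
  have e2 : ∑ y, (c * (if y ∈ ({z} : Finset V) then (1:ℝ) else 0) + 1 * (if y ∈ T then (1:ℝ) else 0)) * ((#(NI G I y) : ℝ) + 2)
      = c * ((#(NI G I z) : ℝ) + 2) + ∑ y ∈ T, ((#(NI G I y) : ℝ) + 2) := by
    have h1 := e1 (fun y => (#(NI G I y) : ℝ) + 2)
    rw [← h1]; exact sum_congr rfl fun y _ => by ring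
  rw [e2] at h
  simp only [e1] at h
  have e3 : c ^ 2 * #(NI G I z) + ∑ y ∈ T, (#(NI G I y) : ℝ) ≤ ∑ i ∈ I, (c * ad G i z + ∑ y ∈ T, ad G i y) ^ 2 := by
    rw [← sum_ad_I, sum_congr rfl fun y _ => (sum_ad_I G I y).symm, sum_comm, mul_sum, ← sum_add_distrib]
    refine sum_le_sum fun i _ => ?_
    have a1 := sum_ad_le_sq (G := G) T i
    have a2 : 0 ≤ ∑ y ∈ T, ad G i y := sum_nonneg fun y _ => ad_nonneg _ _ _
    have a3 := ad_sq G i z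
    have a4 := mul_nonneg (mul_nonneg hc (ad_nonneg G i z)) a2
    nlinarith
  linarith

end Part5

section Part6
open Finset
variable {V : Type*} [Fintype V] {G : SimpleGraph V} {I : Finset V}

lemma Setup.m_le_five (H : Setup G I) {x : V} (hx : x ∉ I) : #(NI G I x) ≤ 5 := by
  have h := H.ind {x} (by simpa using hx)
  have h19 := H.low x hx
  simp only [card_singleton, sum_singleton, ad_sq, sum_ad_I] at h
  by_contra hh
  have h6 : 6 ≤ #(NI G I x) := by omega
  have a1 : (6:ℝ) ≤ #(NI G I x) := by exact_mod_cast h6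
  have a2 : (#(NI G I x) : ℝ) ≤ 19 := by exact_mod_cast h19
  have := ad_nonneg G x x
  push_cast at h
  nlinarith

lemma sum_ad_pair [DecidableEq V] (y y' : V) : ∑ i ∈ I, ad G i y * ad G i y' = #(NI G I y ∩ NI G I y') := by
  classical
  have : NI G I y ∩ NI G I y' = I.filter (fun i => G.Adj y i ∧ G.Adj y' i) := by
    ext i; simp only [mem_inter, mem_NI, mem_filter]; tauto
  rw [this, card_filter]
  push_cast
  refine sum_congr rfl fun i _ => ?_
  rw [ad_symm G i y, ad_symm G i y']
  by_cases h : G.Adj y i <;> by_cases h' : G.Adj y' i <;> simp [ad, h, h']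

lemma Setup.pair5 [DecidableEq V] (H : Setup G I) {y y' : V} (hy : y ∉ I) (hy' : y' ∉ I) (hne : y ≠ y')
    (h5 : #(NI G I y) = 5) (h5' : #(NI G I y') = 5) : #(NI G I y ∩ NI G I y') ≤ 1 := by
  have h := H.ind {y, y'} (by simp [hy, hy'])
  rw [card_pair hne, sum_pair hne, sum_pair hne, sum_pair hne, sum_pair hne] at h
  have e : ∑ i ∈ I, (∑ w ∈ ({y, y'} : Finset V), ad G i w) ^ 2 =
      ∑ i ∈ I, ad G i y + ∑ i ∈ I, ad G i y' + 2 * ∑ i ∈ I, ad G i y * ad G i y' := by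
    rw [mul_sum, ← sum_add_distrib, ← sum_add_distrib]
    refine sum_congr rfl fun i _ => ?_
    rw [sum_pair hne]
    have := ad_sq G i y
    have := ad_sq G i y'
    linarith [add_sq (ad G i y) (ad G i y')]
  rw [e, sum_ad_I, sum_ad_I, sum_ad_pair, h5, h5'] at h
  have := ad_nonneg G y y
  have := ad_nonneg G y y'
  have := ad_nonneg G y' y
  have := ad_nonneg G y' y'
  by_contra hh
  have h2 : (2:ℝ) ≤ #(NI G I y ∩ NI G I y') := by
    have : 2 ≤ #(NI G I y ∩ NI G I y') := by omega
    exact_mod_cast this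
  push_cast at h
  linarith

lemma Setup.disj4 [DecidableEq V] (H : Setup G I) {z y y' : V} (hz : z ∉ I) (hzm : #(NI G I z) ≤ 4)
    (hy : y ∈ NX G I z) (hy' : y' ∈ NX G I z) (hne : y ≠ y')
    (h4 : #(NI G I y) = 4) (h4' : #(NI G I y') = 4) : Disjoint (NI G I y) (NI G I y') := by
  rw [mem_NX] at hy hy'
  have n1 : z ≠ y := hy.2.ne
  have n2 : z ≠ y' := hy'.2.ne
  have hn : z ∉ ({y, y'} : Finset V) := by simp [n1, n2]
  have h := H.ind {z, y, y'} (by simp [hz, hy.1, hy'.1])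
  have e : ∑ i ∈ I, ad G i z + ∑ i ∈ I, ad G i y + ∑ i ∈ I, ad G i y' + 2 * ∑ i ∈ I, ad G i y * ad G i y' ≤
      ∑ i ∈ I, (∑ w ∈ ({z, y, y'} : Finset V), ad G i w) ^ 2 := by
    rw [mul_sum, ← sum_add_distrib, ← sum_add_distrib, ← sum_add_distrib]
    refine sum_le_sum fun i _ => ?_
    rw [sum_insert hn, sum_pair hne]
    have := ad_sq G i y
    have := ad_sq G i y'
    have := ad_sq G i z
    have := mul_nonneg (ad_nonneg G i z) (ad_nonneg G i y)
    have := mul_nonneg (ad_nonneg G i z) (ad_nonneg G i y')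
    nlinarith
  have e2 : (4:ℝ) ≤ ∑ u ∈ ({z, y, y'} : Finset V), ∑ v ∈ ({z, y, y'} : Finset V), ad G u v := by
    simp only [sum_insert hn, sum_pair hne]
    have := ad_nonneg G z z
    have := ad_nonneg G y y
    have := ad_nonneg G y y'
    have := ad_nonneg G y' y
    have := ad_nonneg G y' y'
    have := ad_of_adj hy.2
    have := ad_of_adj hy'.2
    have := ad_of_adj hy.2.symm
    have := ad_of_adj hy'.2.symm
    linarith
  rw [sum_ad_I, sum_ad_I, sum_ad_I, sum_ad_pair] at e
  rw [card_insert_of_notMem hn, card_pair hne] at h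
  have e3 : ∑ w ∈ ({z, y, y'} : Finset V), ((#(NI G I w) : ℝ) + 2) = #(NI G I z) + 14 := by
    rw [sum_insert hn, sum_pair hne, h4, h4']; push_cast; ring
  rw [e3] at h
  rw [h4, h4'] at e
  by_contra hd
  have h2 : (1:ℝ) ≤ #(NI G I y ∩ NI G I y') := by
    have : 1 ≤ #(NI G I y ∩ NI G I y') := by
      rw [Nat.one_le_iff_ne_zero, Ne, card_eq_zero, ← disjoint_iff_inter_eq_empty]; exact hd
    exact_mod_cast this
  have h3 : (#(NI G I z) : ℝ) ≤ 4 := by exact_mod_cast hzm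
  have h0 : (0:ℝ) ≤ #(NI G I z) := by positivity
  push_cast at h e
  nlinarith

lemma Setup.noX5 (H : Setup G I) {x : V} (hx : x ∉ I) (h5 : #(NI G I x) = 5) : NX G I x = ∅ := by
  rw [eq_empty_iff_forall_notMem]
  intro y hy
  have h := H.star x hx {y} (by simpa using hy) 4 (by norm_num)
  have hm := H.m_le_five (mem_NX.1 hy).1
  simp only [card_singleton, sum_singleton, h5] at h
  have a1 : (#(NI G I y) : ℝ) ≤ 5 := by exact_mod_cast hm
  have a2 : (0:ℝ) ≤ #(NI G I y) := by positivity
  push_cast at h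
  nlinarith

lemma Setup.fewSmall (H : Setup G I) {z : V} (hz : z ∉ I) (hzm : #(NI G I z) ≤ 4) :
    #((NX G I z).filter fun y => #(NI G I y) ≤ 3) + #(NI G I z) ≤ 8 := by
  by_contra hh
  obtain ⟨T, hT, hTc⟩ := exists_subset_card_eq
    (show 9 - #(NI G I z) ≤ #((NX G I z).filter fun y => #(NI G I y) ≤ 3) by omega)
  have h := H.star z hz T (hT.trans (filter_subset _ _)) 4 (by norm_num)
  have hs : ∑ y ∈ T, (#(NI G I y) : ℝ) ≤ 3 * #T := by
    have := sum_le_card_nsmul T (fun y => (#(NI G I y) : ℝ)) 3 (fun y hy => by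
      have := (mem_filter.1 (hT hy)).2
      exact_mod_cast this)
    rw [nsmul_eq_mul] at this; linarith
  have hs0 : 0 ≤ ∑ y ∈ T, (#(NI G I y) : ℝ) := sum_nonneg fun _ _ => by positivity
  rw [sum_add_distrib, sum_const, nsmul_eq_mul] at h
  have hc : (#T : ℝ) = 9 - #(NI G I z) := by
    have : #T + #(NI G I z) = 9 := by omega
    have : (#T : ℝ) + #(NI G I z) = 9 := by exact_mod_cast this
    linarith
  generalize ∑ y ∈ T, (#(NI G I y) : ℝ) = s at *
  rw [hc] at h hs
  generalize #(NI G I z) = m at *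
  interval_cases m <;> norm_num at h hs <;> nlinarith

lemma Setup.few4 (H : Setup G I) {z : V} (hz : z ∉ I) (hzm : #(NI G I z) ≤ 4) :
    #((NX G I z).filter fun y => #(NI G I y) = 4) ≤ 9 := by
  classical
  set T := (NX G I z).filter fun y => #(NI G I y) = 4 with hT
  have h1 : #(T.biUnion (NI G I)) = ∑ y ∈ T, #(NI G I y) := by
    refine card_biUnion fun y hy y' hy' hne => ?_
    replace hy := mem_filter.1 (mem_coe.1 hy)
    replace hy' := mem_filter.1 (mem_coe.1 hy')
    exact H.disj4 hz hzm hy.1 hy'.1 hne hy.2 hy'.2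
  have h2 : ∑ y ∈ T, #(NI G I y) = #T * 4 := by
    rw [sum_congr rfl fun y hy => show #(NI G I y) = 4 from (mem_filter.1 hy).2]; simp [hT]
  have h3 : #(T.biUnion (NI G I)) ≤ #I := card_le_card (by
    intro i hi
    obtain ⟨y, _, hi⟩ := mem_biUnion.1 hi
    exact (mem_NI.1 hi).1)
  rw [H.card] at h3
  omega

lemma Setup.few5 (H : Setup G I) {v : V} (hv : v ∈ I) :
    #((NX G I v).filter fun y => #(NI G I y) = 5) ≤ 9 := by
  classical
  set T := (NX G I v).filter fun y => #(NI G I y) = 5 with hT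
  have hmem : ∀ y ∈ T, y ∉ I ∧ v ∈ NI G I y ∧ #(NI G I y) = 5 := by
    intro y hy
    rw [hT, mem_filter, mem_NX] at hy
    exact ⟨hy.1.1, mem_NI.2 ⟨hv, hy.1.2.symm⟩, hy.2⟩
  have h1 : #(T.biUnion fun y => (NI G I y).erase v) = ∑ y ∈ T, #((NI G I y).erase v) := by
    refine card_biUnion fun y hy y' hy' hne => ?_
    obtain ⟨a1, a2, a3⟩ := hmem y hy
    obtain ⟨b1, b2, b3⟩ := hmem y' hy'
    have h := H.pair5 a1 b1 hne a3 b3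
    simp only [Function.onFun]
    rw [Finset.disjoint_left]
    intro i hi hi'
    rw [mem_erase] at hi hi'
    exact hi.1 (card_le_one.1 h i (mem_inter.2 ⟨hi.2, hi'.2⟩) v (mem_inter.2 ⟨a2, b2⟩))
  have h2 : ∑ y ∈ T, #((NI G I y).erase v) = #T * 4 := by
    rw [sum_congr rfl fun y hy => show #((NI G I y).erase v) = 4 by
      obtain ⟨a1, a2, a3⟩ := hmem y hy
      rw [card_erase_of_mem a2, a3]]
    simp
  have h3 : #(T.biUnion fun y => (NI G I y).erase v) ≤ #(I.erase v) := card_le_card (by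
    intro i hi
    obtain ⟨y, _, hi⟩ := mem_biUnion.1 hi
    rw [mem_erase] at hi ⊢
    exact ⟨hi.1, (mem_NI.1 hi.2).1⟩)
  rw [card_erase_of_mem hv, H.card] at h3
  omega

lemma Setup.fewI (H : Setup G I) {v : V} (hv : v ∈ I) :
    #((NX G I v).filter fun y => #(NI G I y) ≤ 4) ≤ 6 := by
  classical
  by_contra hh
  obtain ⟨T, hT, hTc⟩ := exists_subset_card_eq
    (show 7 ≤ #((NX G I v).filter fun y => #(NI G I y) ≤ 4) by omega)
  have hm : ∀ y ∈ T, y ∉ I ∧ G.Adj v y ∧ #(NI G I y) ≤ 4 := by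
    intro y hy
    have := hT hy
    rw [mem_filter, mem_NX] at this
    exact ⟨this.1.1, this.1.2, this.2⟩
  have h := H.ind T fun y hy => (hm y hy).1
  have e0 : 0 ≤ ∑ u ∈ T, ∑ v ∈ T, ad G u v := sum_nonneg fun u _ => sum_nonneg fun v _ => ad_nonneg _ _ _
  have ev : ∑ y ∈ T, ad G v y = 7 := by
    rw [sum_congr rfl fun y hy => ad_of_adj (hm y hy).2.1]; simp [hTc]
  have e1 : ∑ y ∈ T, (#(NI G I y) : ℝ) + 42 ≤ ∑ i ∈ I, (∑ y ∈ T, ad G i y) ^ 2 := by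
    rw [sum_congr rfl fun y _ => (sum_ad_I G I y).symm, sum_comm, ← add_sum_erase I _ hv,
      ← add_sum_erase I (fun i => (∑ y ∈ T, ad G i y) ^ 2) hv, ev]
    have : ∑ i ∈ I.erase v, ∑ y ∈ T, ad G i y ≤ ∑ i ∈ I.erase v, (∑ y ∈ T, ad G i y) ^ 2 :=
      sum_le_sum fun i _ => sum_ad_le_sq (G := G) T i
    linarith
  have hs : ∑ y ∈ T, (#(NI G I y) : ℝ) ≤ 28 := by
    have := sum_le_card_nsmul T (fun y => (#(NI G I y) : ℝ)) 4 (fun y hy => by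
      have := (hm y hy).2.2
      exact_mod_cast this)
    rw [nsmul_eq_mul, hTc] at this; norm_num at this; exact this
  have hs0 : 0 ≤ ∑ y ∈ T, (#(NI G I y) : ℝ) := sum_nonneg fun _ _ => by positivity
  rw [sum_add_distrib, sum_const, nsmul_eq_mul, hTc] at h
  push_cast at h
  generalize ∑ y ∈ T, (#(NI G I y) : ℝ) = s at *
  nlinarith

lemma Setup.NI_I (H : Setup G I) {v : V} (hv : v ∈ I) : NI G I v = ∅ := by
  rw [eq_empty_iff_forall_notMem]
  intro u hu
  rw [mem_NI] at hu
  exact H.indep v hv u hu.1 hu.2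

/-- degree of vertices of I -/
lemma Setup.dgI (H : Setup G I) {v : V} (hv : v ∈ I) : dg G v ≤ 15 := by
  classical
  rw [dg_eq G I, H.NI_I hv, card_empty]
  have h1 := H.fewI hv
  have h2 := H.few5 hv
  have : NX G I v ⊆ ((NX G I v).filter fun y => #(NI G I y) ≤ 4) ∪ ((NX G I v).filter fun y => #(NI G I y) = 5) := by
    intro y hy
    have := H.m_le_five (mem_NX.1 hy).1
    simp only [mem_union, mem_filter, hy, true_and]
    omega
  have := (card_le_card this).trans (card_union_le _ _)
  omega

lemma Setup.dgI' (H : Setup G I) (h4 : ∀ x, x ∉ I → #(NI G I x) ≤ 4) {v : V} (hv : v ∈ I) : dg G v ≤ 6 := by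
  rw [dg_eq G I, H.NI_I hv, card_empty]
  have h1 := H.fewI hv
  rw [filter_true_of_mem fun y hy => h4 y (mem_NX.1 hy).1] at h1
  omega

lemma Setup.dgX (H : Setup G I) (h4 : ∀ x, x ∉ I → #(NI G I x) ≤ 4) {z : V} (hz : z ∉ I) : dg G z ≤ 17 := by
  classical
  rw [dg_eq G I]
  have h1 := H.fewSmall hz (h4 z hz)
  have h2 := H.few4 hz (h4 z hz)
  have : NX G I z ⊆ ((NX G I z).filter fun y => #(NI G I y) ≤ 3) ∪ ((NX G I z).filter fun y => #(NI G I y) = 4) := by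
    intro y hy
    have := h4 y (mem_NX.1 hy).1
    simp only [mem_union, mem_filter, hy, true_and]
    omega
  have := (card_le_card this).trans (card_union_le _ _)
  omega

/-- kernel bound from a `K_{1,5}` -/
lemma Setup.k15 [DecidableEq V] (H : Setup G I) (x : V) (T : Finset V) (hT : ∀ y ∈ T, G.Adj x y) (h5 : #T = 5) :
    Module.finrank ℝ (kerM G) ≤ (dg G x + 1) + ∑ v ∈ T, (dg G v + 1) := by
  have hx : x ∉ T := fun h => G.loopless.irrefl x (hT x h)
  have hq := qf_star G x T hT 2
  rw [h5] at hq
  have h := bad_finrank G H.psd (insert x T) _ (fun v hv => by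
    rw [mem_insert, not_or] at hv
    simp [hv.1, hv.2]) (lt_of_le_of_lt hq (by norm_num))
  refine h.trans ((card_cnbr_le _ _).trans ?_)
  rw [sum_insert hx]

theorem Setup.core (H : Setup G I) (hn : 277 ≤ Fintype.card V) :
    3 * (Module.finrank ℝ (kerM G) + 1) ≤ Fintype.card V := by
  classical
  by_cases hB : ∀ x : V → ℝ, 0 ≤ qf G x
  · exact psd_finrank G hB (by omega)
  push Not at hB
  obtain ⟨x0, hx0⟩ := hB
  by_cases c1 : ∃ x, x ∉ I ∧ #(NI G I x) = 5
  · obtain ⟨x, hx, h5⟩ := c1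
    have h := H.k15 x (NI G I x) (fun y hy => (mem_NI.1 hy).2) h5
    have hd : dg G x = 5 := by rw [dg_eq G I, H.noX5 hx h5, h5]; simp
    have hs : ∑ v ∈ NI G I x, (dg G v + 1) ≤ #(NI G I x) • 16 :=
      sum_le_card_nsmul _ _ _ fun v hv => by
        have := H.dgI (mem_NI.1 hv).1
        omega
    rw [h5, smul_eq_mul] at hs
    omega
  have h4 : ∀ x, x ∉ I → #(NI G I x) ≤ 4 := by
    intro x hx
    have := H.m_le_five hx
    have : #(NI G I x) ≠ 5 := fun h => c1 ⟨x, hx, h⟩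
    omega
  by_cases c2 : ∃ x z, x ∉ I ∧ #(NI G I x) = 4 ∧ z ∈ NX G I x
  · obtain ⟨x, z, hx, hm, hz⟩ := c2
    have hz' := mem_NX.1 hz
    have hzn : z ∉ NI G I x := fun h => hz'.1 (mem_NI.1 h).1
    have h := H.k15 x (insert z (NI G I x)) (fun y hy => by
      rcases mem_insert.1 hy with rfl | hy
      · exact hz'.2
      · exact (mem_NI.1 hy).2) (by rw [card_insert_of_notMem hzn, hm])
    rw [sum_insert hzn] at h
    have hs : ∑ v ∈ NI G I x, (dg G v + 1) ≤ #(NI G I x) • 7 :=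
      sum_le_card_nsmul _ _ _ fun v hv => by
        have := H.dgI' h4 (mem_NI.1 hv).1
        omega
    rw [hm, smul_eq_mul] at hs
    have := H.dgX h4 hx
    have := H.dgX h4 hz'.1
    omega
  have hd : ∀ v, dg G v ≤ 8 := by
    intro v
    by_cases hv : v ∈ I
    · exact (H.dgI' h4 hv).trans (by norm_num)
    by_cases hm : #(NI G I v) = 4
    · have : NX G I v = ∅ := by
        rw [eq_empty_iff_forall_notMem]
        intro z hz
        exact c2 ⟨v, z, hv, hm, hz⟩
      rw [dg_eq G I, hm, this]; simp
    · have h1 := H.fewSmall hv (h4 v hv)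
      rw [filter_true_of_mem fun y hy => ?_] at h1
      · rw [dg_eq G I]; omega
      · have hy' := mem_NX.1 hy
        have := h4 y hy'.1
        have : #(NI G I y) ≠ 4 := fun h => c2 ⟨y, v, hy'.1, h, mem_NX.2 ⟨hv, hy'.2.symm⟩⟩
        omega
  have hb := smith G x0 hx0
  unfold NoBad at hb
  push Not at hb
  obtain ⟨F, f, hF, hf, hq⟩ := hb
  have h := (bad_finrank G H.psd F f hf hq).trans (card_cnbr_le G F)
  have hs : ∑ v ∈ F, (dg G v + 1) ≤ #F • 9 :=
    sum_le_card_nsmul _ _ _ fun v _ => by have := hd v; omega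
  rw [smul_eq_mul] at hs
  omega

end Part6

section Final
open Finset

/-- the graph obtained after switching by `ε` -/
def gr {n : ℕ} (S : Matrix (Fin n) (Fin n) ℝ) (ε : Fin n → ℝ) : SimpleGraph (Fin n) :=
  SimpleGraph.fromRel fun i j => ε i * ε j * S i j = -1

lemma gr_adj {n : ℕ} {S : Matrix (Fin n) (Fin n) ℝ} (hS : IsSeidel S) (ε : Fin n → ℝ) (i j : Fin n) :
    (gr S ε).Adj i j ↔ i ≠ j ∧ ε i * ε j * S i j = -1 := by
  unfold gr
  rw [SimpleGraph.fromRel_adj]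
  have : S j i = S i j := hS.1.apply i j
  rw [this, mul_comm (ε j) (ε i), or_self]

lemma gr_entry {n : ℕ} {S : Matrix (Fin n) (Fin n) ℝ} (hS : IsSeidel S) (ε : Fin n → ℝ)
    (hε : ∀ i, ε i = 1 ∨ ε i = -1) (i j : Fin n) :
    ε i * ε j * (S + (5 : ℝ) • (1 : Matrix (Fin n) (Fin n) ℝ)) i j =
      (if i = j then 4 else 0) + 1 - 2 * ad (gr S ε) i j := by
  by_cases h : i = j
  · subst h
    have h0 : ¬ (gr S ε).Adj i i := (gr S ε).loopless.irrefl i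
    rw [ad_of_not h0]
    have := hS.2.1 i
    simp only [Matrix.add_apply, Matrix.smul_apply, Matrix.one_apply_eq, this, if_true]
    rcases hε i with h | h <;> rw [h] <;> norm_num
  · have e : (S + (5 : ℝ) • (1 : Matrix (Fin n) (Fin n) ℝ)) i j = S i j := by
      simp [Matrix.one_apply_ne h]
    rw [e, if_neg h]
    by_cases hA : (gr S ε).Adj i j
    · rw [ad_of_adj hA, ((gr_adj hS ε i j).1 hA).2]; norm_num
    · rw [ad_of_not hA]
      have hne : ε i * ε j * S i j ≠ -1 := fun hh => hA ((gr_adj hS ε i j).2 ⟨h, hh⟩)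
      rcases hε i with h1 | h1 <;> rcases hε j with h2 | h2 <;> rcases hS.2.2 i j h with h3 | h3 <;>
        simp [h1, h2, h3] at hne ⊢

lemma eps_sq {n : ℕ} {ε : Fin n → ℝ} (hε : ∀ i, ε i = 1 ∨ ε i = -1) (i : Fin n) : ε i * ε i = 1 := by
  rcases hε i with h | h <;> rw [h] <;> norm_num

lemma ker_le {n : ℕ} {S : Matrix (Fin n) (Fin n) ℝ} (hS : IsSeidel S) (ε : Fin n → ℝ)
    (hε : ∀ i, ε i = 1 ∨ ε i = -1) :
    n ≤ (S + (5 : ℝ) • (1 : Matrix (Fin n) (Fin n) ℝ)).rank + Module.finrank ℝ (kerM (gr S ε)) := by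
  set B := S + (5 : ℝ) • (1 : Matrix (Fin n) (Fin n) ℝ) with hB
  have h1 := LinearMap.finrank_range_add_finrank_ker B.mulVecLin
  rw [Module.finrank_fin_fun] at h1
  have hmap : ∀ x ∈ LinearMap.ker B.mulVecLin, (fun i => ε i * x i) ∈ kerM (gr S ε) := by
    intro x hx
    rw [LinearMap.mem_ker] at hx
    intro v
    have hv : ∑ u, B v u * x u = 0 := congrFun hx v
    have e : 4 * (ε v * x v) - 2 * ∑ u, ad (gr S ε) v u * (ε u * x u) + ∑ u, ε u * x u =
        ∑ u, ((if v = u then 4 else 0) + 1 - 2 * ad (gr S ε) v u) * (ε u * x u) := by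
      simp only [sub_mul, add_mul, sum_add_distrib, sum_sub_distrib, mul_assoc, ← mul_sum, one_mul]
      simp
      ring
    simp only [e]
    have : ∑ u, ((if v = u then 4 else 0) + 1 - 2 * ad (gr S ε) v u) * (ε u * x u) =
        ε v * ∑ u, B v u * x u := by
      rw [mul_sum]
      refine sum_congr rfl fun u _ => ?_
      rw [← gr_entry hS ε hε v u]
      linear_combination (ε v * B v u * x u) * eps_sq hε u
    rw [this, hv, mul_zero]
  let f : LinearMap.ker B.mulVecLin →ₗ[ℝ] kerM (gr S ε) :=
    { toFun := fun x => ⟨fun i => ε i * x.1 i, hmap x.1 x.2⟩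
      map_add' := fun x y => by ext i; simp [mul_add]
      map_smul' := fun c x => by ext i; simp; ring }
  have hf : Function.Injective f := by
    intro x y hxy
    ext i
    have h : ε i * x.1 i = ε i * y.1 i := congrFun (congrArg Subtype.val hxy) i
    have := eps_sq hε i
    calc x.1 i = ε i * (ε i * x.1 i) := by rw [← mul_assoc, this, one_mul]
      _ = ε i * (ε i * y.1 i) := by rw [h]
      _ = y.1 i := by rw [← mul_assoc, this, one_mul]
  have h2 := LinearMap.finrank_le_finrank_of_injective hf
  have h3 : B.rank = Module.finrank ℝ (LinearMap.range B.mulVecLin) := rfl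
  omega

lemma seidel_psd {n : ℕ} {S : Matrix (Fin n) (Fin n) ℝ} (hS : IsSeidel S) (hmin : minEig S = -5) :
    (S + (5 : ℝ) • (1 : Matrix (Fin n) (Fin n) ℝ)).PosSemidef := by
  have hH : S.IsHermitian := by
    rw [Matrix.IsHermitian, Matrix.conjTranspose_eq_transpose_of_trivial]; exact hS.1
  have hB : (S + (5 : ℝ) • (1 : Matrix (Fin n) (Fin n) ℝ)).IsHermitian := by
    rw [Matrix.IsHermitian, Matrix.conjTranspose_eq_transpose_of_trivial, Matrix.transpose_add, hS.1]
    simp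
  rw [hB.posSemidef_iff_eigenvalues_nonneg]
  intro i
  have h1 := hB.eigenvalues_mem_spectrum_real i
  have e : S + (5 : ℝ) • (1 : Matrix (Fin n) (Fin n) ℝ) = algebraMap ℝ _ 5 + S := by
    rw [Algebra.algebraMap_eq_smul_one, add_comm]
  set μ := hB.eigenvalues i with hμ
  have h2 : (μ - 5) + 5 ∈ spectrum ℝ (algebraMap ℝ (Matrix (Fin n) (Fin n) ℝ) 5 + S) := by
    rw [← e, sub_add_cancel]; exact h1
  rw [spectrum.add_mem_add_iff, hH.spectrum_real_eq_range_eigenvalues] at h2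
  obtain ⟨k, hk⟩ := h2
  unfold minEig at hmin
  rw [dif_pos hH] at hmin
  have h3 : ⨅ i, hH.eigenvalues i ≤ hH.eigenvalues k := ciInf_le (Set.finite_range _).bddBelow k
  rw [hmin, hk] at h3
  change 0 ≤ μ
  linarith

lemma gr_psd {n : ℕ} {S : Matrix (Fin n) (Fin n) ℝ} (hS : IsSeidel S) (hmin : minEig S = -5)
    (ε : Fin n → ℝ) (hε : ∀ i, ε i = 1 ∨ ε i = -1) (x : Fin n → ℝ) :
    0 ≤ qf (gr S ε) x + (∑ v, x v) ^ 2 := by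
  have h := (seidel_psd hS hmin).dotProduct_mulVec_nonneg (fun i => ε i * x i)
  refine h.trans_eq (Eq.symm ?_)
  simp only [dotProduct, Matrix.mulVec, star_trivial, qf]
  rw [sq, sum_mul_sum, mul_sum, mul_sum, ← sum_sub_distrib, ← sum_add_distrib]
  refine sum_congr rfl fun u _ => ?_
  have e : 4 * x u ^ 2 = ∑ v, (if u = v then (4:ℝ) else 0) * (x u * x v) := by
    simp; ring
  rw [e, mul_sum, mul_sum, ← sum_sub_distrib, ← sum_add_distrib]
  refine sum_congr rfl fun v _ => ?_
  linear_combination (-(x u * x v)) * gr_entry hS ε hε u v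

lemma switch_adj {n : ℕ} {S : Matrix (Fin n) (Fin n) ℝ} (hS : IsSeidel S) {i j : Fin n} (hij : i ≠ j) :
    ((switchGraph S).Adj (Sum.inl i) (Sum.inl j) ↔ S i j = -1) ∧
    ((switchGraph S).Adj (Sum.inr i) (Sum.inr j) ↔ S i j = -1) ∧
    ((switchGraph S).Adj (Sum.inl i) (Sum.inr j) ↔ S i j = 1) ∧
    ((switchGraph S).Adj (Sum.inr i) (Sum.inl j) ↔ S i j = 1) := by
  have h : S j i = S i j := hS.1.apply i j
  simp only [switchGraph, SimpleGraph.fromRel_adj, Matrix.fromBlocks_apply₁₁, Matrix.fromBlocks_apply₁₂,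
    Matrix.fromBlocks_apply₂₁, Matrix.fromBlocks_apply₂₂, Matrix.sub_apply, Matrix.one_apply_ne hij,
    Matrix.one_apply_ne hij.symm, h, or_self]
  simp [hij]

lemma exists_setup {n : ℕ} {S : Matrix (Fin n) (Fin n) ℝ} (hS : IsSeidel S) (hmin : minEig S = -5)
    (hα : 39 ≤ indepNum (switchGraph S)) :
    ∃ (ε : Fin n → ℝ) (I : Finset (Fin n)), (∀ i, ε i = 1 ∨ ε i = -1) ∧ Setup (gr S ε) I := by
  classical
  obtain ⟨C₀, hC₀⟩ := SimpleGraph.exists_isNClique_cliqueNum (G := (switchGraph S)ᶜ)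
  obtain ⟨C, hCs, hCc⟩ := exists_subset_card_eq (show 39 ≤ #C₀ by rw [hC₀.card_eq]; exact hα)
  have hC : ∀ a ∈ C, ∀ b ∈ C, ¬ (switchGraph S).Adj a b := by
    intro a ha b hb hab
    have := hC₀.isClique (mem_coe.2 (hCs ha)) (mem_coe.2 (hCs hb)) hab.ne
    rw [SimpleGraph.compl_adj] at this
    exact this.2 hab
  have hboth : ∀ i, Sum.inl i ∈ C → Sum.inr i ∈ C → False := by
    intro i h1 h2
    have : ∃ w ∈ C, w ∉ ({Sum.inl i, Sum.inr i} : Finset (Fin n ⊕ Fin n)) := by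
      apply exists_mem_notMem_of_card_lt_card
      rw [hCc]
      exact lt_of_le_of_lt card_le_two (by norm_num)
    obtain ⟨w, hw, hwn⟩ := this
    rcases w with j | j
    · have hij : i ≠ j := by rintro rfl; simp at hwn
      obtain ⟨a1, a2, a3, a4⟩ := switch_adj hS hij
      rcases hS.2.2 i j hij with h | h
      · exact hC _ h2 _ hw (a4.2 h)
      · exact hC _ h1 _ hw (a1.2 h)
    · have hij : i ≠ j := by rintro rfl; simp at hwn
      obtain ⟨a1, a2, a3, a4⟩ := switch_adj hS hij
      rcases hS.2.2 i j hij with h | h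
      · exact hC _ h1 _ hw (a3.2 h)
      · exact hC _ h2 _ hw (a2.2 h)
  set p : Fin n ⊕ Fin n → Fin n := Sum.elim id id with hp
  set I : Finset (Fin n) := C.image p with hI
  have hmemI : ∀ i, i ∈ I ↔ Sum.inl i ∈ C ∨ Sum.inr i ∈ C := by
    intro i
    rw [hI, mem_image]
    constructor
    · rintro ⟨w, hw, rfl⟩
      rcases w with j | j
      · exact Or.inl hw
      · exact Or.inr hw
    · rintro (h | h)
      · exact ⟨_, h, rfl⟩
      · exact ⟨_, h, rfl⟩
  have hIc : #I = 39 := by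
    rw [hI, card_image_of_injOn, hCc]
    intro a ha b hb hab
    rcases a with i | i <;> rcases b with j | j <;> simp only [hp, Sum.elim_inl, Sum.elim_inr, id] at hab <;> subst hab
    · rfl
    · exact (hboth _ ha hb).elim
    · exact (hboth _ hb ha).elim
    · rfl
  set e0 : Fin n → ℝ := fun i => if Sum.inl i ∈ C then 1 else -1 with he0
  set ε : Fin n → ℝ := fun x => if x ∈ I then e0 x else
    if #(I.filter fun i => e0 i * S x i = -1) ≤ 19 then 1 else -1 with hε
  have e0pm : ∀ i, e0 i = 1 ∨ e0 i = -1 := by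
    intro i; simp only [he0]; split_ifs <;> simp
  have hpm : ∀ i, ε i = 1 ∨ ε i = -1 := by
    intro i; simp only [hε]
    by_cases h : i ∈ I
    · rw [if_pos h]; exact e0pm i
    · rw [if_neg h]; split_ifs <;> simp
  have hεI : ∀ i ∈ I, ε i = e0 i := fun i hi => by simp only [hε]; rw [if_pos hi]
  refine ⟨ε, I, hpm, gr_psd hS hmin ε hpm, hIc, ?_, ?_⟩
  · intro i hi j hj hadj
    rw [gr_adj hS] at hadj
    obtain ⟨hij, hadj⟩ := hadj
    rw [hεI i hi, hεI j hj] at hadj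
    obtain ⟨a1, a2, a3, a4⟩ := switch_adj hS hij
    rw [hmemI] at hi hj
    simp only [he0] at hadj
    by_cases c1 : Sum.inl i ∈ C <;> by_cases c2 : Sum.inl j ∈ C
    · rw [if_pos c1, if_pos c2] at hadj
      exact hC _ c1 _ c2 (a1.2 (by linarith))
    · rw [if_pos c1, if_neg c2] at hadj
      exact hC _ c1 _ (hj.resolve_left c2) (a3.2 (by linarith))
    · rw [if_neg c1, if_pos c2] at hadj
      exact hC _ (hi.resolve_left c1) _ c2 (a4.2 (by linarith))
    · rw [if_neg c1, if_neg c2] at hadj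
      exact hC _ (hi.resolve_left c1) _ (hj.resolve_left c2) (a2.2 (by linarith))
  · intro x hx
    have hne : ∀ i ∈ I, x ≠ i := fun i hi h => hx (h ▸ hi)
    by_cases hk : #(I.filter fun i => e0 i * S x i = -1) ≤ 19
    · have hεx : ε x = 1 := by simp only [hε]; rw [if_neg hx, if_pos hk]
      refine le_trans (card_le_card ?_) hk
      intro i hi
      rw [mem_NI, gr_adj hS, hεx, one_mul] at hi
      rw [mem_filter]
      rw [hεI i hi.1] at hi
      exact ⟨hi.1, hi.2.2⟩
    · have hεx : ε x = -1 := by simp only [hε]; rw [if_neg hx, if_neg hk]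
      have hsub : NI (gr S ε) I x ⊆ I.filter fun i => ¬ (e0 i * S x i = -1) := by
        intro i hi
        rw [mem_NI, gr_adj hS, hεx] at hi
        rw [mem_filter]
        rw [hεI i hi.1] at hi
        refine ⟨hi.1, fun h => ?_⟩
        have := hi.2.2
        linarith
      have h1 := card_le_card hsub
      have h2 := card_filter_add_card_filter_not (s := I) (fun i => e0 i * S x i = -1)
      rw [hIc] at h2
      omega

end Final

/-- If `S` is a Seidel matrix of order `n ≥ 277` with smallest eigenvalue
exactly `-5`, `ω([S]) = 4` and `α([S]) ≥ 39`, then `rk(S + 5I) ≥ 2n/3 + 1`. -/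
theorem stmt_6 {n : ℕ} (S : Matrix (Fin n) (Fin n) ℝ) (hS : IsSeidel S)
    (hmin : minEig S = -5) (hn : 277 ≤ n)
    (hω : (switchGraph S).cliqueNum = 4)
    (hα : 39 ≤ indepNum (switchGraph S)) :
    2 * (n : ℝ) / 3 + 1 ≤ ((S + (5 : ℝ) • 1).rank : ℝ) := by
  obtain ⟨ε, I, hε, H⟩ := exists_setup hS hmin hα
  have h1 := H.core (by simpa using hn)
  rw [Fintype.card_fin] at h1
  have h2 := ker_le hS ε hε
  have h3 : 2 * n + 3 ≤ 3 * (S + (5 : ℝ) • (1 : Matrix (Fin n) (Fin n) ℝ)).rank := by omega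
  have h4 : 2 * (n : ℝ) + 3 ≤ 3 * ((S + (5 : ℝ) • (1 : Matrix (Fin n) (Fin n) ℝ)).rank : ℝ) := by
    exact_mod_cast h3
  linarith
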